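/- Smoothness of the self partial covariance (Theorem 3.7, bounds (3.12) and (3.13)). Fix K < ∞, κ > 3, 0 < λ_inf ≤ λ_sup < ∞ and N₀ ∈ ℕ. There exists a constant 𝒦 < ∞, depending only on K, κ, λ_inf, λ_sup, such that whenever Assumption LS(p, K, κ, λ_inf, λ_sup, N₀) holds with p ≥ 2, for all a ∈ {1, …, p}, all N ≥ N₀, all t, τ ∈ ℤ and all u, v ∈ ℝ: |ρ^{(a,a)|−{a}}_{t,τ,N} − ρ^{(a,a)|−{a}}_{t−τ}(t/N)| ≤ 𝒦 ζ(t−τ)^{κ−2} min(1/N, ζ(t−τ)) and |ρ^{(a,a)|−{a}}_{t−τ}(u) − ρ^{(a,a)|−{a}}_{t−τ}(v)| ≤ 𝒦 |u−v| ζ(t−τ)^{κ−1}. -/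

import Mathlib

noncomputable section

/-- `⟨x⟩ = max(1,|x|)` -/
def gu (x : ℝ) : ℝ := max 1 |x|

/-- `ζ(x) = max(1, log⟨x⟩)/⟨x⟩` -/
def zeta (x : ℝ) : ℝ := max 1 (Real.log (gu x)) / gu x

/-- spectral norm of a matrix -/
def specNorm {𝕜 : Type*} [RCLike 𝕜] {m n : Type*} [Fintype m] [Fintype n] [DecidableEq n]
    (M : Matrix m n 𝕜) : ℝ :=
  ‖LinearMap.toContinuousLinearMap (Matrix.toEuclideanLin M)‖

/-- `ℓ²(ι; ℝ^p)` -/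
abbrev HpI (ι : Type) (p : ℕ) : Type := lp (fun _ : ι => EuclideanSpace ℝ (Fin p)) 2

abbrev Hp (p : ℕ) : Type := HpI ℤ p

/-- the sequence `δ_t ⊗ e_a` -/
def bvec {ι : Type} [DecidableEq ι] (p : ℕ) (t : ι) (a : Fin p) : HpI ι p :=
  lp.single 2 t (EuclideanSpace.single a 1)

/-- the `p × p` block `A_{t,τ}` of an operator -/
def blk {ι : Type} [DecidableEq ι] {p : ℕ} (A : HpI ι p →L[ℝ] HpI ι p) (t τ : ι) :
    Matrix (Fin p) (Fin p) ℝ :=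
  Matrix.of fun a b => inner (𝕜 := ℝ) (bvec p t a) (A (bvec p τ b))


/-- Assumption LS(p, K, κ, λ_inf, λ_sup, N₀): a locally stationary family of covariance
operators `𝐂^(N)` together with the smooth local autocovariance functions `C_r(·)`. -/
structure AssumptionLS (p : ℕ) (K κ lamInf lamSup : ℝ) (N₀ : ℕ)
    (C : ℕ → Hp p →L[ℝ] Hp p) (Cr : ℤ → ℝ → Matrix (Fin p) (Fin p) ℝ) : Prop where
  symm : ∀ (N : ℕ) (x y : Hp p), inner (𝕜 := ℝ) ((C N) x) y = inner (𝕜 := ℝ) x ((C N) y)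
  lower : ∀ N : ℕ, N₀ ≤ N → ∀ v : Hp p, lamInf * ‖v‖ ^ 2 ≤ inner (𝕜 := ℝ) v ((C N) v)
  upper : ∀ N : ℕ, N₀ ≤ N → ∀ v : Hp p, inner (𝕜 := ℝ) v ((C N) v) ≤ lamSup * ‖v‖ ^ 2
  decay : ∀ N : ℕ, 1 ≤ N → ∀ t τ : ℤ,
    specNorm (blk (C N) t τ) ≤ K * gu ((t : ℝ) - (τ : ℝ)) ^ (-κ)
  crSymm : ∀ (r : ℤ) (u : ℝ), Cr r u = (Cr (-r) u).transpose
  crBound : ∀ (r : ℤ) (u : ℝ), specNorm (Cr r u) ≤ K * gu (r : ℝ) ^ (-κ)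
  crLip : ∀ (r : ℤ) (u v : ℝ),
    specNorm (Cr r u - Cr r v) ≤ K * |u - v| * gu (r : ℝ) ^ (-κ)
  approx : ∀ N : ℕ, 1 ≤ N → ∀ t τ : ℤ,
    specNorm (blk (C N) t τ - Cr (t - τ) ((t : ℝ) / (N : ℝ))) ≤
      K * gu ((t : ℝ) - (τ : ℝ)) ^ (-κ + 1) *
        min (1 / (N : ℝ)) (2 / gu ((t : ℝ) - (τ : ℝ)))

/-- `ℓ²(ℤ; ℝ^α)` for a finite index set `α` of components -/
abbrev HE (α : Type) [Fintype α] : Type := lp (fun _ : ℤ => EuclideanSpace ℝ α) 2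

/-- the sequence `δ_t ⊗ e_i` in `ℓ²(ℤ; ℝ^α)` -/
def bvE {α : Type} [Fintype α] [DecidableEq α] (t : ℤ) (i : α) : HE α :=
  lp.single 2 t (EuclideanSpace.single i 1)

/-- the scalar entry of an operator between component-restricted sequence spaces -/
def entE {α β : Type} [Fintype α] [DecidableEq α] [Fintype β] [DecidableEq β]
    (B : HE β →L[ℝ] HE α) (t τ : ℤ) (i : α) (j : β) : ℝ :=
  inner (𝕜 := ℝ) (bvE t i) (B (bvE τ j))

/-- the scalar `(t,τ)` entry of the Schur complement
`𝐂_{a,a} − 𝐂_{a,S′} 𝐄 (𝐂_{a,S′})^*` (the single component `a` is indexed by `Fin 1`) -/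
def schurEnt {β : Type} [Fintype β] [DecidableEq β]
    (Caa : HE (Fin 1) →L[ℝ] HE (Fin 1)) (CaSp : HE β →L[ℝ] HE (Fin 1))
    (E : HE β →L[ℝ] HE β) (t τ : ℤ) : ℝ :=
  inner (𝕜 := ℝ) (bvE t (0 : Fin 1))
    ((Caa - CaSp.comp (E.comp (ContinuousLinearMap.adjoint CaSp))) (bvE τ (0 : Fin 1)))

open Filter Topology

/-- The sequence in `ℓ²(ℤ; ℝ^α)` equal to `x` at index `s` and to `0` elsewhere. -/
abbrev sqSingle {α : Type} [Fintype α] (s : ℤ) (x : EuclideanSpace ℝ α) : HE α :=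
  lp.single (E := fun _ : ℤ => EuclideanSpace ℝ α) 2 s x

/-- The `(s, τ)` block of `A` has spectral norm at most `c`, phrased bilinearly. -/
def BlockBound {α β : Type} [Fintype α] [Fintype β] (A : HE β →L[ℝ] HE α) (s τ : ℤ) (c : ℝ) :
    Prop :=
  ∀ (x : EuclideanSpace ℝ α) (y : EuclideanSpace ℝ β),
    |inner ℝ (sqSingle s x) (A (sqSingle τ y))| ≤ c * ‖x‖ * ‖y‖

section Blocks

variable {α β γ : Type} [Fintype α] [Fintype β] [Fintype γ]

lemma norm_sqSingle (s : ℤ) (x : EuclideanSpace ℝ α) : ‖sqSingle s x‖ = ‖x‖ :=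
  lp.norm_single (E := fun _ : ℤ => EuclideanSpace ℝ α) (p := 2) (by norm_num) s x

lemma BlockBound.mono {A : HE β →L[ℝ] HE α} {s τ : ℤ} {c d : ℝ} (h : BlockBound A s τ c)
    (hcd : c ≤ d) : BlockBound A s τ d := fun x y =>
  (h x y).trans (by gcongr)

lemma BlockBound.add {A B : HE β →L[ℝ] HE α} {s τ : ℤ} {c d : ℝ} (hA : BlockBound A s τ c)
    (hB : BlockBound B s τ d) : BlockBound (A + B) s τ (c + d) := fun x y => by
  rw [add_apply, inner_add_right]
  linarith [abs_add_le (inner ℝ (sqSingle s x) (A (sqSingle τ y)))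
    (inner ℝ (sqSingle s x) (B (sqSingle τ y))), hA x y, hB x y]

lemma BlockBound.neg {A : HE β →L[ℝ] HE α} {s τ : ℤ} {c : ℝ} (hA : BlockBound A s τ c) :
    BlockBound (-A) s τ c := fun x y => by
  rw [neg_apply, inner_neg_right, abs_neg]
  exact hA x y

lemma BlockBound.sub {A B : HE β →L[ℝ] HE α} {s τ : ℤ} {c d : ℝ} (hA : BlockBound A s τ c)
    (hB : BlockBound B s τ d) : BlockBound (A - B) s τ (c + d) := by
  rw [sub_eq_add_neg]
  exact hA.add hB.neg

lemma BlockBound.adjoint {A : HE β →L[ℝ] HE α} {s τ : ℤ} {c : ℝ} (hA : BlockBound A s τ c) :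
    BlockBound (ContinuousLinearMap.adjoint A) τ s c := fun x y => by
  rw [ContinuousLinearMap.adjoint_inner_right, real_inner_comm]
  linarith [hA y x]

lemma sum_norm_sq_le (v : HE α) (F : Finset ℤ) : ∑ k ∈ F, ‖v k‖ ^ 2 ≤ ‖v‖ ^ 2 := by
  have h := lp.sum_rpow_le_norm_rpow (p := 2) (by norm_num) v F
  simpa using h

lemma norm_sq_sum_sqSingle (F : Finset ℤ) (f : ℤ → EuclideanSpace ℝ α) :
    ‖∑ k ∈ F, sqSingle k (f k)‖ ^ 2 = ∑ k ∈ F, ‖f k‖ ^ 2 := by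
  have h := lp.norm_sum_single (E := fun _ : ℤ => EuclideanSpace ℝ α) (p := 2) (by norm_num) f F
  simpa using h

lemma hasSum_sqSingle (v : HE α) : HasSum (fun k => sqSingle k (v k)) v :=
  lp.hasSum_single (E := fun _ : ℤ => EuclideanSpace ℝ α) (p := 2) (by norm_num) v

lemma BlockBound.norm_apply_le {A : HE β →L[ℝ] HE α} {s τ : ℤ} {c : ℝ} (hA : BlockBound A s τ c)
    (hc : 0 ≤ c) (y : EuclideanSpace ℝ β) : ‖A (sqSingle τ y) s‖ ≤ c * ‖y‖ := by
  set x := A (sqSingle τ y) s with hx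
  have h := hA x y
  rw [lp.inner_single_left, ← hx, real_inner_self_eq_norm_sq, abs_of_nonneg (by positivity)] at h
  rcases (norm_nonneg x).eq_or_lt with h0 | h0
  · rw [← h0]; positivity
  · nlinarith

lemma hasSum_inner_apply (A : HE β →L[ℝ] HE α) (z : HE α) (v : HE β) :
    HasSum (fun k => inner ℝ z (A (sqSingle k (v k)))) (inner ℝ z (A v)) :=
  ((hasSum_sqSingle v).mapL A).mapL (innerSL ℝ z)

lemma abs_le_of_hasSum {f : ℤ → ℝ} {a c : ℝ} (h : HasSum f a)
    (hc : ∀ F : Finset ℤ, ∑ k ∈ F, |f k| ≤ c) : |a| ≤ c :=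
  le_of_tendsto (f := fun F : Finset ℤ => |∑ k ∈ F, f k|)
    ((continuous_abs.tendsto a).comp h)
    (Eventually.of_forall fun F => (Finset.abs_sum_le_sum_abs _ _).trans (hc F))

lemma BlockBound.comp {A : HE β →L[ℝ] HE α} {B : HE γ →L[ℝ] HE β} {s τ : ℤ} {a b : ℤ → ℝ} {c : ℝ}
    (hA : ∀ k, BlockBound A s k (a k)) (hB : ∀ k, BlockBound B k τ (b k))
    (ha : ∀ k, 0 ≤ a k) (hb : ∀ k, 0 ≤ b k) (hc : ∀ F : Finset ℤ, ∑ k ∈ F, a k * b k ≤ c) :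
    BlockBound (A.comp B) s τ c := fun x y => by
  refine abs_le_of_hasSum (hasSum_inner_apply A (sqSingle s x) (B (sqSingle τ y))) fun F => ?_
  calc ∑ k ∈ F, |inner ℝ (sqSingle s x) (A (sqSingle k (B (sqSingle τ y) k)))|
      ≤ ∑ k ∈ F, a k * b k * (‖x‖ * ‖y‖) := by
        refine Finset.sum_le_sum fun k _ => (hA k _ _).trans ?_
        have h1 := (hB k).norm_apply_le (hb k) y
        have h2 : 0 ≤ a k * ‖x‖ := mul_nonneg (ha k) (norm_nonneg x)
        calc _ ≤ a k * ‖x‖ * (b k * ‖y‖) := by gcongr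
          _ = _ := by ring
    _ ≤ c * (‖x‖ * ‖y‖) := by
        rw [← Finset.sum_mul]
        have := hc F
        gcongr
    _ = c * ‖x‖ * ‖y‖ := by ring

/-- Schur's test with a convolution weight. -/
lemma abs_inner_apply_le_of_convolution (A : HE β →L[ℝ] HE α) (z : HE α) (v : HE β)
    {a : ℤ → ℝ} {S : ℝ} (ha : ∀ r, 0 ≤ a r) (hS : ∀ F : Finset ℤ, ∑ r ∈ F, a r ≤ S)
    (h : ∀ s τ, |inner ℝ (sqSingle s (z s)) (A (sqSingle τ (v τ)))| ≤
      a (s - τ) * ‖z s‖ * ‖v τ‖) :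
    |inner ℝ z (A v)| ≤ S * ‖z‖ * ‖v‖ := by
  have hS0 : 0 ≤ S := by simpa using hS ∅
  have hz := hasSum_sqSingle z
  have hv := (hasSum_sqSingle v).mapL A
  have hlim : Tendsto (fun F : Finset ℤ => |inner ℝ (∑ s ∈ F, sqSingle s (z s))
      (∑ τ ∈ F, A (sqSingle τ (v τ)))|) atTop (𝓝 |inner ℝ z (A v)|) :=
    (Filter.Tendsto.inner (𝕜 := ℝ) hz hv).abs
  refine le_of_tendsto hlim (Eventually.of_forall fun F => ?_)
  have hrow : ∀ s, ∑ τ ∈ F, a (s - τ) ≤ S := fun s => by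
    rw [← Finset.sum_image (s := F) (g := fun τ => s - τ) (f := a)
      (fun x _ y _ hxy => by simpa using hxy)]
    exact hS _
  have hcol : ∀ τ, ∑ s ∈ F, a (s - τ) ≤ S := fun τ => by
    rw [← Finset.sum_image (s := F) (g := fun s => s - τ) (f := a)
      (fun x _ y _ hxy => by simpa using hxy)]
    exact hS _
  have h1 : |inner ℝ (∑ s ∈ F, sqSingle s (z s)) (∑ τ ∈ F, A (sqSingle τ (v τ)))| ≤
      ∑ q ∈ F ×ˢ F, (√(a (q.1 - q.2)) * ‖z q.1‖) * (√(a (q.1 - q.2)) * ‖v q.2‖) := by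
    rw [sum_inner, Finset.sum_product]
    simp_rw [inner_sum]
    refine (Finset.abs_sum_le_sum_abs _ _).trans (Finset.sum_le_sum fun s _ => ?_)
    refine (Finset.abs_sum_le_sum_abs _ _).trans (Finset.sum_le_sum fun τ _ => ?_)
    refine (h s τ).trans (le_of_eq ?_)
    have := Real.mul_self_sqrt (ha (s - τ))
    linear_combination (-‖z s‖ * ‖v τ‖) * this
  have h2 := Finset.sum_mul_sq_le_sq_mul_sq (F ×ˢ F)
    (fun q => √(a (q.1 - q.2)) * ‖z q.1‖) (fun q => √(a (q.1 - q.2)) * ‖v q.2‖)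
  have h3 : ∑ q ∈ F ×ˢ F, (√(a (q.1 - q.2)) * ‖z q.1‖) ^ 2 ≤ S * ‖z‖ ^ 2 := by
    rw [Finset.sum_product]
    calc _ = ∑ s ∈ F, (∑ τ ∈ F, a (s - τ)) * ‖z s‖ ^ 2 := by
          refine Finset.sum_congr rfl fun s _ => ?_
          rw [Finset.sum_mul]
          exact Finset.sum_congr rfl fun τ _ => by rw [mul_pow, Real.sq_sqrt (ha _)]
      _ ≤ ∑ s ∈ F, S * ‖z s‖ ^ 2 := by gcongr with s; exact hrow s
      _ ≤ _ := by rw [← Finset.mul_sum]; gcongr; exact sum_norm_sq_le z F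
  have h4 : ∑ q ∈ F ×ˢ F, (√(a (q.1 - q.2)) * ‖v q.2‖) ^ 2 ≤ S * ‖v‖ ^ 2 := by
    rw [Finset.sum_product_right]
    calc _ = ∑ τ ∈ F, (∑ s ∈ F, a (s - τ)) * ‖v τ‖ ^ 2 := by
          refine Finset.sum_congr rfl fun s _ => ?_
          rw [Finset.sum_mul]
          exact Finset.sum_congr rfl fun τ _ => by rw [mul_pow, Real.sq_sqrt (ha _)]
      _ ≤ ∑ τ ∈ F, S * ‖v τ‖ ^ 2 := by gcongr with τ; exact hcol τ
      _ ≤ _ := by rw [← Finset.mul_sum]; gcongr; exact sum_norm_sq_le v F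
  refine h1.trans (abs_le_of_sq_le_sq' (h2.trans ?_) (by positivity)).2
  calc _ ≤ (S * ‖z‖ ^ 2) * (S * ‖v‖ ^ 2) := by gcongr
    _ = _ := by ring

end Blocks

section Entries

variable {α β : Type} [Fintype α] [Fintype β] {p : ℕ}

/-- Extension of a vector by zero along `f`. -/
def spread (f : α → Fin p) (x : EuclideanSpace ℝ α) : EuclideanSpace ℝ (Fin p) :=
  ∑ i, x i • EuclideanSpace.single (f i) (1 : ℝ)

lemma norm_spread {f : α → Fin p} (hf : f.Injective) (x : EuclideanSpace ℝ α) :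
    ‖spread f x‖ = ‖x‖ := by
  have h := ((EuclideanSpace.orthonormal_single (𝕜 := ℝ) (ι := Fin p)).comp f hf).inner_sum
    (fun i => x i) (fun i => x i) Finset.univ
  have h2 : ‖spread f x‖ ^ 2 = ‖x‖ ^ 2 := by
    rw [← real_inner_self_eq_norm_sq, EuclideanSpace.norm_sq_eq]
    refine h.trans (Finset.sum_congr rfl fun i _ => ?_)
    simp [sq]
  exact (sq_eq_sq₀ (norm_nonneg _) (norm_nonneg _)).1 h2

lemma inner_single_toEuclideanLin_single (M : Matrix (Fin p) (Fin p) ℝ) (i j : Fin p) :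
    inner ℝ (EuclideanSpace.single i (1 : ℝ))
      (Matrix.toEuclideanLin M (EuclideanSpace.single j (1 : ℝ))) = M i j := by
  simp [Matrix.toLpLin_apply, EuclideanSpace.inner_single_left]

lemma inner_spread_toEuclideanLin (f : α → Fin p) (g : β → Fin p) (M : Matrix (Fin p) (Fin p) ℝ)
    (x : EuclideanSpace ℝ α) (y : EuclideanSpace ℝ β) :
    inner ℝ (spread f x) (Matrix.toEuclideanLin M (spread g y)) =
      ∑ i, ∑ j, x i * y j * M (f i) (g j) := by
  simp only [spread, map_sum, map_smul, sum_inner, inner_sum, real_inner_smul_left,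
    real_inner_smul_right, inner_single_toEuclideanLin_single]
  rw [Finset.sum_comm]
  exact Finset.sum_congr rfl fun i _ => Finset.sum_congr rfl fun j _ => by ring

lemma abs_inner_toEuclideanLin_le (M : Matrix (Fin p) (Fin p) ℝ)
    (x y : EuclideanSpace ℝ (Fin p)) :
    |inner ℝ x (Matrix.toEuclideanLin M y)| ≤ specNorm M * ‖x‖ * ‖y‖ := by
  have h := (LinearMap.toContinuousLinearMap (Matrix.toEuclideanLin M)).le_opNorm y
  calc _ ≤ ‖x‖ * ‖Matrix.toEuclideanLin M y‖ := abs_real_inner_le_norm _ _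
    _ ≤ ‖x‖ * (specNorm M * ‖y‖) := by gcongr; exact h
    _ = _ := by ring

lemma specNorm_nonneg (M : Matrix (Fin p) (Fin p) ℝ) : 0 ≤ specNorm M := norm_nonneg _

lemma sqSingle_eq_sum [DecidableEq α] (s : ℤ) (x : EuclideanSpace ℝ α) :
    sqSingle s x = ∑ i, x i • bvE s i := by
  have hx : x = ∑ i, x i • EuclideanSpace.single i (1 : ℝ) := by
    ext k
    simp [Pi.single_apply]
  conv_lhs => rw [hx]
  simp only [sqSingle, bvE]
  have := map_sum (lp.lsingle (𝕜 := ℝ) (E := fun _ : ℤ => EuclideanSpace ℝ α) 2 s)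
    (fun i => x i • EuclideanSpace.single i (1 : ℝ)) Finset.univ
  refine this.trans (Finset.sum_congr rfl fun i _ => ?_)
  exact map_smul (lp.lsingle (𝕜 := ℝ) (E := fun _ : ℤ => EuclideanSpace ℝ α) 2 s) (x i)
    (EuclideanSpace.single i (1 : ℝ))

lemma lower_bound_of_finset {A : HE β →L[ℝ] HE β} {lam : ℝ}
    (h : ∀ (F : Finset ℤ) (z : ℤ → EuclideanSpace ℝ β), lam * ∑ s ∈ F, ‖z s‖ ^ 2 ≤
      ∑ s ∈ F, ∑ τ ∈ F, inner ℝ (sqSingle s (z s)) (A (sqSingle τ (z τ)))) (v : HE β) :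
    lam * ‖v‖ ^ 2 ≤ inner ℝ v (A v) := by
  have hv := hasSum_sqSingle v
  have h1 : Tendsto (fun F : Finset ℤ => lam * ‖∑ s ∈ F, sqSingle s (v s)‖ ^ 2) atTop
      (𝓝 (lam * ‖v‖ ^ 2)) := (((Tendsto.norm hv).pow 2).const_mul lam)
  have h2 : Tendsto (fun F : Finset ℤ => inner ℝ (∑ s ∈ F, sqSingle s (v s))
      (∑ τ ∈ F, A (sqSingle τ (v τ)))) atTop (𝓝 (inner ℝ v (A v))) :=
    Filter.Tendsto.inner (𝕜 := ℝ) hv (hv.mapL A)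
  refine le_of_tendsto_of_tendsto' h1 h2 fun F => ?_
  rw [norm_sq_sum_sqSingle F (fun s => v s), sum_inner]
  simp_rw [inner_sum]
  exact h F fun s => v s

variable [DecidableEq α] [DecidableEq β]

lemma inner_sqSingle_apply_eq {A : HE β →L[ℝ] HE α} {s τ : ℤ} {f : α → Fin p} {g : β → Fin p}
    {M : Matrix (Fin p) (Fin p) ℝ} (h : ∀ i j, entE A s τ i j = M (f i) (g j))
    (x : EuclideanSpace ℝ α) (y : EuclideanSpace ℝ β) :
    inner ℝ (sqSingle s x) (A (sqSingle τ y)) =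
      inner ℝ (spread f x) (Matrix.toEuclideanLin M (spread g y)) := by
  rw [inner_spread_toEuclideanLin, sqSingle_eq_sum s, sqSingle_eq_sum τ]
  simp only [map_sum, map_smul, sum_inner, inner_sum, real_inner_smul_left,
    real_inner_smul_right, ← h, entE]
  rw [Finset.sum_comm]
  exact Finset.sum_congr rfl fun i _ => Finset.sum_congr rfl fun j _ => by ring

lemma blockBound_of_entE {A : HE β →L[ℝ] HE α} {s τ : ℤ} {f : α → Fin p} {g : β → Fin p}
    {M : Matrix (Fin p) (Fin p) ℝ} (hf : f.Injective) (hg : g.Injective)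
    (h : ∀ i j, entE A s τ i j = M (f i) (g j)) : BlockBound A s τ (specNorm M) := fun x y => by
  rw [inner_sqSingle_apply_eq h, ← norm_spread hf x, ← norm_spread hg y]
  exact abs_inner_toEuclideanLin_le _ _ _

lemma entE_sub (A B : HE β →L[ℝ] HE α) (s τ : ℤ) (i : α) (j : β) :
    entE (A - B) s τ i j = entE A s τ i j - entE B s τ i j := by
  simp only [entE, sub_apply, inner_sub_right]

lemma spread_id (x : EuclideanSpace ℝ (Fin p)) : spread id x = x := by
  ext k
  simp [spread, Pi.single_apply]

lemma lower_bound_shift {B : Hp p →L[ℝ] Hp p} {lam : ℝ}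
    (hB : ∀ v : Hp p, lam * ‖v‖ ^ 2 ≤ inner ℝ v (B v)) (h : ℤ) (F : Finset ℤ)
    (z : ℤ → EuclideanSpace ℝ (Fin p)) :
    lam * ∑ s ∈ F, ‖z s‖ ^ 2 ≤ ∑ s ∈ F, ∑ τ ∈ F,
      inner ℝ (z s) (Matrix.toEuclideanLin (blk B (s + h) (τ + h)) (z τ)) := by
  have hinj : Set.InjOn (fun s : ℤ => s + h) F := fun x _ y _ hxy => by simpa using hxy
  have h1 := hB (∑ s ∈ F, sqSingle (s + h) (z s))
  have h2 : ‖∑ s ∈ F, sqSingle (s + h) (z s)‖ ^ 2 = ∑ s ∈ F, ‖z s‖ ^ 2 := by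
    have := norm_sq_sum_sqSingle (F.image fun s => s + h) (fun k => z (k - h))
    rw [Finset.sum_image hinj, Finset.sum_image hinj] at this
    simpa using this
  rw [h2, sum_inner] at h1
  refine h1.trans (le_of_eq ?_)
  simp only [map_sum, inner_sum]
  refine Finset.sum_congr rfl fun s _ => Finset.sum_congr rfl fun τ _ => ?_
  have h3 := inner_sqSingle_apply_eq (A := B) (s := s + h) (τ := τ + h) (f := id) (g := id)
    (M := blk B (s + h) (τ + h)) (fun i j => rfl) (z s) (z τ)
  rwa [spread_id, spread_id] at h3

end Entries

section Weights

lemma one_le_gu (x : ℝ) : 1 ≤ gu x := le_max_left _ _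

lemma gu_pos (x : ℝ) : 0 < gu x := one_pos.trans_le (one_le_gu x)

lemma gu_neg (x : ℝ) : gu (-x) = gu x := by simp [gu]

lemma gu_sub_comm (x y : ℝ) : gu (x - y) = gu (y - x) := by rw [← gu_neg, neg_sub]

lemma gu_zero : gu 0 = 1 := by simp [gu]

lemma gu_add_le (x y : ℝ) : gu (x + y) ≤ gu x + gu y := by
  unfold gu
  refine max_le ?_ ((abs_add_le x y).trans (add_le_add (le_max_right _ _) (le_max_right _ _)))
  linarith [le_max_left 1 |x|, le_max_left 1 |y|]

lemma abs_le_gu (x : ℝ) : |x| ≤ gu x := le_max_right _ _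

/-- The weight `⟨s - τ⟩^(-a)`. -/
def polyWeight (a : ℝ) (s τ : ℤ) : ℝ := gu ((s : ℝ) - τ) ^ (-a)

lemma polyWeight_pos (a : ℝ) (s τ : ℤ) : 0 < polyWeight a s τ := Real.rpow_pos_of_pos (gu_pos _) _

lemma polyWeight_nonneg (a : ℝ) (s τ : ℤ) : 0 ≤ polyWeight a s τ := (polyWeight_pos a s τ).le

lemma polyWeight_comm (a : ℝ) (s τ : ℤ) : polyWeight a s τ = polyWeight a τ s := by
  rw [polyWeight, gu_sub_comm, polyWeight]

lemma polyWeight_self (a : ℝ) (s : ℤ) : polyWeight a s s = 1 := by simp [polyWeight, gu_zero]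

lemma polyWeight_anti {a b : ℝ} (h : a ≤ b) (s τ : ℤ) : polyWeight b s τ ≤ polyWeight a s τ :=
  Real.rpow_le_rpow_of_exponent_le (one_le_gu _) (by linarith)

lemma polyWeight_sub_zero (a : ℝ) (s τ : ℤ) : polyWeight a (s - τ) 0 = polyWeight a s τ := by
  simp [polyWeight]

lemma gu_rpow_mul_polyWeight (a b : ℝ) (s τ : ℤ) :
    gu ((s : ℝ) - τ) ^ b * polyWeight a s τ = polyWeight (a - b) s τ := by
  rw [polyWeight, polyWeight, ← Real.rpow_add (gu_pos _)]
  ring_nf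

lemma summable_polyWeight {a : ℝ} (ha : 1 < a) : Summable fun r : ℤ => polyWeight a r 0 := by
  refine (Real.summable_abs_int_rpow ha).congr_cofinite ?_
  filter_upwards [(Set.finite_singleton (0 : ℤ)).compl_mem_cofinite] with r hr
  have hr' : r ≠ 0 := hr
  have h1 : (1 : ℝ) ≤ |(r : ℝ)| := by
    rw [← Int.cast_abs]; exact_mod_cast Int.one_le_abs hr'
  simp [polyWeight, gu, max_eq_right h1]

/-- Upper bound for the row sums of `polyWeight`. -/
def weightSum (a : ℝ) : ℝ := ∑' r : ℤ, polyWeight a r 0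

lemma sum_polyWeight_zero_le {a : ℝ} (ha : 1 < a) (F : Finset ℤ) :
    ∑ r ∈ F, polyWeight a r 0 ≤ weightSum a :=
  (summable_polyWeight ha).sum_le_tsum F fun _ _ => polyWeight_nonneg _ _ _

lemma sum_polyWeight_le {a : ℝ} (ha : 1 < a) (τ : ℤ) (F : Finset ℤ) :
    ∑ k ∈ F, polyWeight a k τ ≤ weightSum a := by
  calc _ = ∑ k ∈ F, polyWeight a (k - τ) 0 := by simp only [polyWeight_sub_zero]
    _ = ∑ r ∈ F.image fun k => k - τ, polyWeight a r 0 :=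
        (Finset.sum_image (f := fun r => polyWeight a r 0) (g := fun k => k - τ)
          (fun x _ y _ hxy => by simpa using hxy)).symm
    _ ≤ _ := sum_polyWeight_zero_le ha _

lemma weightSum_nonneg (a : ℝ) : 0 ≤ weightSum a := tsum_nonneg fun _ => polyWeight_nonneg _ _ _

/-- Constant in the convolution inequality for `polyWeight`. -/
def convConst (a : ℝ) : ℝ := 2 ^ a * (2 * weightSum a)

lemma convConst_nonneg (a : ℝ) : 0 ≤ convConst a := by
  have := weightSum_nonneg a
  unfold convConst; positivity

lemma polyWeight_mul_le {a : ℝ} (ha : 1 < a) (s k τ : ℤ) :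
    polyWeight a s k * polyWeight a k τ ≤
      2 ^ a * polyWeight a s τ * (polyWeight a k s + polyWeight a k τ) := by
  have htri : gu ((s : ℝ) - τ) ≤ gu ((s : ℝ) - k) + gu ((k : ℝ) - τ) := by
    have := gu_add_le ((s : ℝ) - k) (k - τ)
    rwa [sub_add_sub_cancel] at this
  have key : ∀ x : ℝ, gu ((s : ℝ) - τ) ≤ 2 * gu x → gu x ^ (-a) ≤ 2 ^ a * polyWeight a s τ := by
    intro x hx
    have h1 : (2 * gu x) ^ (-a) ≤ gu ((s : ℝ) - τ) ^ (-a) :=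
      Real.rpow_le_rpow_of_nonpos (gu_pos _) hx (by linarith)
    rw [Real.mul_rpow (by norm_num) (gu_pos x).le] at h1
    calc gu x ^ (-a) = 2 ^ a * (2 ^ (-a) * gu x ^ (-a)) := by
          rw [← mul_assoc, ← Real.rpow_add (by norm_num)]; simp
      _ ≤ _ := by unfold polyWeight; gcongr
  have hs := polyWeight_nonneg a s k
  have hk := polyWeight_nonneg a k τ
  have h0 : 0 ≤ 2 ^ a * polyWeight a s τ := by
    have := polyWeight_nonneg a s τ
    positivity
  rw [polyWeight_comm a k s]
  rcases le_total (gu ((s : ℝ) - k)) (gu ((k : ℝ) - τ)) with h | h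
  · have := key _ (by linarith : gu ((s : ℝ) - τ) ≤ 2 * gu ((k : ℝ) - τ))
    change polyWeight a k τ ≤ _ at this
    nlinarith [mul_le_mul_of_nonneg_left this hs, mul_nonneg h0 hk]
  · have := key _ (by linarith : gu ((s : ℝ) - τ) ≤ 2 * gu ((s : ℝ) - k))
    change polyWeight a s k ≤ _ at this
    nlinarith [mul_le_mul_of_nonneg_right this hk, mul_nonneg h0 hs]

lemma sum_polyWeight_mul_le {a : ℝ} (ha : 1 < a) (s τ : ℤ) (F : Finset ℤ) :
    ∑ k ∈ F, polyWeight a s k * polyWeight a k τ ≤ convConst a * polyWeight a s τ := by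
  have h0 : 0 ≤ 2 ^ a * polyWeight a s τ := by
    have := polyWeight_nonneg a s τ
    positivity
  calc _ ≤ ∑ k ∈ F, 2 ^ a * polyWeight a s τ * (polyWeight a k s + polyWeight a k τ) :=
        Finset.sum_le_sum fun k _ => polyWeight_mul_le ha s k τ
    _ ≤ 2 ^ a * polyWeight a s τ * (weightSum a + weightSum a) := by
        rw [← Finset.mul_sum, Finset.sum_add_distrib]
        gcongr <;> exact sum_polyWeight_le ha _ F
    _ = _ := by unfold convConst; ring

lemma rpow_neg_le_sub {a x : ℝ} (ha : 2 ≤ a) (hx : 1 ≤ x) :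
    x ^ (-a) ≤ a * (x ^ (-(a - 1)) - (x + 1) ^ (-(a - 1))) := by
  have hx0 : 0 < x := by linarith
  have hb := one_add_mul_self_le_rpow_one_add (s := 1 / x) (p := a - 1)
    (by have : 0 ≤ 1 / x := by positivity
        linarith) (by linarith)
  have h1 : (x + 1) ^ (-(a - 1)) = x ^ (-(a - 1)) * ((1 + 1 / x) ^ (a - 1))⁻¹ := by
    rw [← Real.rpow_neg (by positivity), ← Real.mul_rpow hx0.le (by positivity)]
    congr 1
    field_simp
  have h2 : x ^ (-a) = x ^ (-(a - 1)) * (1 / x) := by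
    rw [one_div, ← Real.rpow_neg_one x, ← Real.rpow_add hx0]
    ring_nf
  have h3 : ((1 + 1 / x) ^ (a - 1))⁻¹ ≤ (1 + (a - 1) * (1 / x))⁻¹ := by
    have : 0 ≤ (a - 1) * (1 / x) := mul_nonneg (by linarith) (by positivity)
    gcongr
  have h4 : 1 / x ≤ a * (1 - (1 + (a - 1) * (1 / x))⁻¹) := by
    have h5 : 0 < x + (a - 1) := by linarith
    have h6 : (1 + (a - 1) * (1 / x))⁻¹ = x / (x + (a - 1)) := by
      field_simp
    rw [h6, one_sub_div h5.ne', ← mul_div_assoc, div_le_div_iff₀ hx0 h5]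
    nlinarith [mul_nonneg (by linarith : (0 : ℝ) ≤ a - 1) (by linarith : (0 : ℝ) ≤ x - 1),
      mul_nonneg (by linarith : (0 : ℝ) ≤ a - 2) hx0.le,
      mul_nonneg (mul_nonneg (by linarith : (0 : ℝ) ≤ a - 2) hx0.le)
        (by linarith : (0 : ℝ) ≤ a - 1)]
  rw [h1, h2]
  calc x ^ (-(a - 1)) * (1 / x)
      ≤ x ^ (-(a - 1)) * (a * (1 - (1 + (a - 1) * (1 / x))⁻¹)) := by gcongr
    _ ≤ x ^ (-(a - 1)) * (a * (1 - ((1 + 1 / x) ^ (a - 1))⁻¹)) := by gcongr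
    _ = _ := by ring

lemma sum_Ico_rpow_neg_le {a : ℝ} (ha : 2 ≤ a) {n₀ : ℕ} (h₀ : 1 ≤ n₀) (n : ℕ) :
    ∑ k ∈ Finset.Ico n₀ n, (k : ℝ) ^ (-a) ≤ a * (n₀ : ℝ) ^ (-(a - 1)) := by
  rcases le_total n₀ n with hn | hn
  · have : ∑ k ∈ Finset.Ico n₀ n, (k : ℝ) ^ (-a) ≤
        a * ((n₀ : ℝ) ^ (-(a - 1)) - (n : ℝ) ^ (-(a - 1))) := by
      induction n, hn using Nat.le_induction with
      | base => simp
      | succ m hm ih =>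
        rw [Finset.sum_Ico_succ_top hm]
        have := rpow_neg_le_sub ha (x := m) (by exact_mod_cast h₀.trans hm)
        push_cast
        linarith
    have h2 : 0 ≤ a * (n : ℝ) ^ (-(a - 1)) := by positivity
    linarith
  · rw [Finset.Ico_eq_empty_of_le hn]
    simp only [Finset.sum_empty]
    positivity

lemma sum_natAbs_le {h : ℕ → ℝ} {S : ℝ} (h0 : ∀ n, 0 ≤ h n)
    (hS : ∀ n, ∑ k ∈ Finset.range n, h k ≤ S) (F : Finset ℤ) :
    ∑ r ∈ F, h r.natAbs ≤ 2 * S := by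
  have hG : ∀ G : Finset ℤ, Set.InjOn Int.natAbs (G : Set ℤ) → ∑ r ∈ G, h r.natAbs ≤ S := by
    intro G hinj
    rw [← Finset.sum_image hinj]
    obtain ⟨n, hn⟩ := (G.image Int.natAbs).exists_nat_subset_range
    exact (Finset.sum_le_sum_of_subset_of_nonneg hn fun _ _ _ => h0 _).trans (hS n)
  rw [← Finset.sum_filter_add_sum_filter_not F (fun r : ℤ => 0 ≤ r)]
  have h1 := hG (F.filter fun r : ℤ => 0 ≤ r) (fun x hx y hy hxy => by
    simp only [Finset.coe_filter, Set.mem_ofPred_eq] at hx hy; omega)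
  have h2 := hG (F.filter fun r : ℤ => ¬ 0 ≤ r) (fun x hx y hy hxy => by
    simp only [Finset.coe_filter, Set.mem_ofPred_eq] at hx hy; omega)
  linarith

lemma sum_tail_polyWeight_le {a m : ℝ} (ha : 2 ≤ a) (hm : 0 < m) (F : Finset ℤ) :
    ∑ r ∈ F, (if m < |(r : ℝ)| then polyWeight a r 0 else 0) ≤ 2 * (a * m ^ (-(a - 1))) := by
  set h : ℕ → ℝ := fun n => if m < (n : ℝ) then (n : ℝ) ^ (-a) else 0 with hh
  have h0 : ∀ n, 0 ≤ h n := fun n => by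
    simp only [hh]; split_ifs <;> positivity
  have hS : ∀ n, ∑ k ∈ Finset.range n, h k ≤ a * m ^ (-(a - 1)) := fun n => by
    have h1 : 1 ≤ ⌊m⌋₊ + 1 := by omega
    have hlt := Nat.lt_floor_add_one m
    rw [← Finset.sum_filter]
    have hsub : (Finset.range n).filter (fun k : ℕ => m < (k : ℝ)) ⊆ Finset.Ico (⌊m⌋₊ + 1) n := by
      intro k hk
      simp only [Finset.mem_filter, Finset.mem_range] at hk
      rw [Finset.mem_Ico]
      exact ⟨(Nat.floor_lt hm.le).2 hk.2, hk.1⟩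
    refine (Finset.sum_le_sum_of_subset_of_nonneg hsub fun _ _ _ => by positivity).trans
      ((sum_Ico_rpow_neg_le ha h1 n).trans ?_)
    have : ((⌊m⌋₊ + 1 : ℕ) : ℝ) ^ (-(a - 1)) ≤ m ^ (-(a - 1)) :=
      Real.rpow_le_rpow_of_nonpos hm (by push_cast; exact hlt.le) (by linarith)
    gcongr
  refine le_trans (le_of_eq (Finset.sum_congr rfl fun r _ => ?_)) (sum_natAbs_le h0 hS F)
  have hr : ((r.natAbs : ℕ) : ℝ) = |(r : ℝ)| := by
    rw [Nat.cast_natAbs, Int.cast_abs]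
  simp only [hh, hr]
  split_ifs with hc
  · have hr0 : r ≠ 0 := by
      rintro rfl
      simp at hc
      linarith
    have h1 : (1 : ℝ) ≤ |(r : ℝ)| := by
      rw [← Int.cast_abs]; exact_mod_cast Int.one_le_abs hr0
    simp [polyWeight, gu, max_eq_right h1]
  · rfl

end Weights

section InverseDecay

variable {β : Type} [Fintype β]

lemma exists_support_split (u : HE β) (S : Set ℤ) :
    ∃ u₁ u₂ : HE β, u = u₁ + u₂ ∧ (∀ s ∉ S, u₁ s = 0) ∧ (∀ s ∈ S, u₂ s = 0) ∧
      ‖u₁‖ ≤ ‖u‖ ∧ inner ℝ u₂ u = ‖u₂‖ ^ 2 := by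
  classical
  have hmem : Memℓp (fun s => if s ∈ S then u s else 0) 2 := by
    have hu := (lp.memℓp u).summable (by norm_num)
    refine memℓp_gen (hu.of_nonneg_of_le (fun s => by positivity) fun s => ?_)
    split_ifs
    · exact le_rfl
    · simp only [norm_zero]
      rw [Real.zero_rpow (by norm_num)]
      positivity
  let u₁ : HE β := ⟨fun s => if s ∈ S then u s else 0, hmem⟩
  have h₁ : ∀ s, u₁ s = if s ∈ S then u s else 0 := fun s => rfl
  have h₂ : ∀ s, (u - u₁) s = if s ∈ S then 0 else u s := fun s => by
    rw [lp.coeFn_sub, Pi.sub_apply, h₁]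
    split_ifs <;> simp
  have horth : inner ℝ (u - u₁) u₁ = 0 := by
    rw [lp.inner_eq_tsum]
    refine (tsum_congr fun s => ?_).trans tsum_zero
    rw [h₁, h₂]
    split_ifs <;> simp
  have hu : u = u₁ + (u - u₁) := by abel
  refine ⟨u₁, u - u₁, hu, fun s hs => by rw [h₁, if_neg hs], fun s hs => by rw [h₂, if_pos hs],
    ?_, ?_⟩
  · have h3 : ‖u‖ ^ 2 = ‖u₁‖ ^ 2 + ‖u - u₁‖ ^ 2 := by
      conv_lhs => rw [hu]
      rw [norm_add_sq_real, real_inner_comm, horth]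
      ring
    exact abs_le_of_sq_le_sq' (by nlinarith [sq_nonneg ‖u - u₁‖]) (norm_nonneg _) |>.2
  · conv_lhs => rw [hu]
    rw [inner_add_right, add_sub_cancel, horth, zero_add, real_inner_self_eq_norm_sq]

/-- Approximate finite speed of propagation for powers of a contraction whose matrix is small away
from the diagonal. -/
lemma exists_pow_apply_split {A : HE β →L[ℝ] HE β} {r T m : ℝ} (hr : 0 ≤ r) (hT : 0 ≤ T)
    (hm : 0 ≤ m) (τ : ℤ) (hA : ∀ v, ‖A v‖ ≤ r * ‖v‖)
    (htail : ∀ (b : ℝ) (v w : HE β), 0 ≤ b → (∀ s : ℤ, b < |(s : ℝ) - τ| → v s = 0) →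
      (∀ s : ℤ, |(s : ℝ) - τ| ≤ b + m → w s = 0) → |inner ℝ w (A v)| ≤ r * T * ‖w‖ * ‖v‖)
    (x : EuclideanSpace ℝ β) (n : ℕ) :
    ∃ y z : HE β, (A ^ n) (sqSingle τ x) = y + z ∧ (∀ s : ℤ, n * m < |(s : ℝ) - τ| → y s = 0) ∧
      ‖y‖ ≤ r ^ n * ‖x‖ ∧ ‖z‖ ≤ n * r ^ n * T * ‖x‖ := by
  induction n with
  | zero =>
    refine ⟨sqSingle τ x, 0, by simp, fun s hs => ?_, by simp, by simp⟩
    have hne : s ≠ τ := by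
      rintro rfl
      simp at hs
    exact lp.single_apply_ne _ _ _ hne
  | succ n ih =>
    obtain ⟨y, z, hyz, hsupp, hy, hz⟩ := ih
    obtain ⟨u₁, u₂, hu, h₁, h₂, hn₁, hn₂⟩ :=
      exists_support_split (A y) {s : ℤ | |(s : ℝ) - τ| ≤ n * m + m}
    have hu₂ : ‖u₂‖ ≤ r * T * ‖y‖ := by
      have h := htail (n * m) y u₂ (by positivity) hsupp (fun s hs => h₂ s hs)
      rw [hn₂, abs_of_nonneg (by positivity)] at h
      rcases (norm_nonneg u₂).eq_or_lt with h0 | h0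
      · rw [← h0]; positivity
      · nlinarith
    refine ⟨u₁, A z + u₂, ?_, fun s hs => h₁ s ?_, ?_, ?_⟩
    · rw [pow_succ', mul_apply_eq_comp, hyz, map_add, hu]
      abel
    · push_cast at hs
      simp only [Set.mem_ofPred_eq, not_le]
      linarith
    · calc ‖u₁‖ ≤ r * ‖y‖ := hn₁.trans (hA y)
        _ ≤ r * (r ^ n * ‖x‖) := by gcongr
        _ = _ := by ring
    · calc ‖A z + u₂‖ ≤ r * ‖z‖ + r * T * ‖y‖ :=
            (norm_add_le _ _).trans (add_le_add (hA z) hu₂)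
        _ ≤ r * (n * r ^ n * T * ‖x‖) + r * T * (r ^ n * ‖x‖) := by gcongr
        _ = _ := by push_cast; ring

lemma norm_pow_apply_le {A : HE β →L[ℝ] HE β} {r : ℝ} (hr : 0 ≤ r) (hA : ∀ v, ‖A v‖ ≤ r * ‖v‖)
    (n : ℕ) (v : HE β) : ‖(A ^ n) v‖ ≤ r ^ n * ‖v‖ := by
  induction n with
  | zero => simp
  | succ n ih =>
    rw [pow_succ', mul_apply_eq_comp]
    calc _ ≤ r * ‖(A ^ n) v‖ := hA _
      _ ≤ r * (r ^ n * ‖v‖) := by gcongr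
      _ = _ := by ring

lemma norm_apply_le_of_blockBound {A : HE β →L[ℝ] HE β} {K κ : ℝ} (hK : 0 ≤ K) (hκ : 1 < κ)
    (hA : ∀ s τ, BlockBound A s τ (K * polyWeight κ s τ)) (v : HE β) :
    ‖A v‖ ≤ K * weightSum κ * ‖v‖ := by
  have h := abs_inner_apply_le_of_convolution A (A v) v (a := fun r => K * polyWeight κ r 0)
    (S := K * weightSum κ) (fun r => mul_nonneg hK (polyWeight_nonneg _ _ _))
    (fun F => by rw [← Finset.mul_sum]; gcongr; exact sum_polyWeight_zero_le hκ F)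
    (fun s τ => by simpa only [polyWeight_sub_zero] using hA s τ _ _)
  rw [real_inner_self_eq_norm_sq, abs_of_nonneg (by positivity)] at h
  have hw := weightSum_nonneg κ
  rcases (norm_nonneg (A v)).eq_or_lt with h0 | h0
  · rw [← h0]; positivity
  · nlinarith

lemma abs_inner_apply_le_of_separated {A : HE β →L[ℝ] HE β} {K κ m b : ℝ} (hK : 0 ≤ K)
    (hκ : 2 ≤ κ) (hm : 0 < m) (hA : ∀ s τ, BlockBound A s τ (K * polyWeight κ s τ))
    (τ : ℤ) (v w : HE β) (hv : ∀ s : ℤ, b < |(s : ℝ) - τ| → v s = 0)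
    (hw : ∀ s : ℤ, |(s : ℝ) - τ| ≤ b + m → w s = 0) :
    |inner ℝ w (A v)| ≤ K * (2 * (κ * m ^ (-(κ - 1)))) * ‖w‖ * ‖v‖ := by
  refine abs_inner_apply_le_of_convolution A w v
    (a := fun r => K * if m < |(r : ℝ)| then polyWeight κ r 0 else 0)
    (fun r => mul_nonneg hK ?_) (fun F => ?_) (fun s σ => ?_)
  · split_ifs
    · exact polyWeight_nonneg _ _ _
    · exact le_rfl
  · rw [← Finset.mul_sum]
    gcongr
    exact sum_tail_polyWeight_le hκ hm F
  · by_cases hs : |(s : ℝ) - τ| ≤ b + m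
    · rw [hw s hs]; simp [sqSingle]
    by_cases hσ : b < |(σ : ℝ) - τ|
    · rw [hv σ hσ]; simp [sqSingle]
    have hfar : m < |((s - σ : ℤ) : ℝ)| := by
      have := abs_sub_abs_le_abs_sub ((s : ℝ) - τ) (σ - τ)
      rw [sub_sub_sub_cancel_right] at this
      push_cast
      linarith
    simp only [if_pos hfar, polyWeight_sub_zero]
    exact hA s σ _ _

lemma norm_sub_smul_apply_le {A : HE β →L[ℝ] HE β} {lam M : ℝ} (hlam : 0 < lam) (hM : lam < M)
    (hlow : ∀ v, lam * ‖v‖ ^ 2 ≤ inner ℝ v (A v)) (hA : ∀ v, ‖A v‖ ≤ M * ‖v‖) (v : HE β) :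
    ‖(ContinuousLinearMap.id ℝ (HE β) - (lam / M ^ 2) • A) v‖ ≤ √(1 - lam ^ 2 / M ^ 2) * ‖v‖ := by
  have hM0 : 0 < M := hlam.trans hM
  have hr : 0 ≤ 1 - lam ^ 2 / M ^ 2 := by
    rw [sub_nonneg, div_le_one (by positivity)]
    gcongr
  refine (abs_le_of_sq_le_sq' ?_ (by positivity)).2
  rw [mul_pow, Real.sq_sqrt hr, sub_apply, smul_apply, ContinuousLinearMap.id_apply,
    norm_sub_sq_real, real_inner_smul_right, norm_smul, mul_pow, Real.norm_eq_abs, sq_abs]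
  have h1 : ‖A v‖ ^ 2 ≤ M ^ 2 * ‖v‖ ^ 2 := by
    rw [← mul_pow]; gcongr; exact hA v
  have h2 : (lam / M ^ 2) ^ 2 * ‖A v‖ ^ 2 ≤ (lam / M ^ 2) ^ 2 * (M ^ 2 * ‖v‖ ^ 2) := by gcongr
  have h3 : lam / M ^ 2 * (lam * ‖v‖ ^ 2) ≤ lam / M ^ 2 * inner ℝ v (A v) := by
    gcongr; exact hlow v
  have h4 : (lam / M ^ 2) ^ 2 * (M ^ 2 * ‖v‖ ^ 2) = lam ^ 2 / M ^ 2 * ‖v‖ ^ 2 := by field_simp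
  have h5 : lam / M ^ 2 * (lam * ‖v‖ ^ 2) = lam ^ 2 / M ^ 2 * ‖v‖ ^ 2 := by ring
  linarith

lemma summable_rpow_mul_geometric {r : ℝ} (hr0 : 0 < r) (hr1 : r < 1) (κ : ℝ) :
    Summable fun n : ℕ => ((n : ℝ) + 1) ^ κ * r ^ n := by
  have h := (summable_nat_add_iff 1).2 (summable_pow_mul_geometric_of_norm_lt_one (R := ℝ) ⌈κ⌉₊
    (r := r) (by rwa [Real.norm_of_nonneg hr0.le]))
  refine (h.mul_left r⁻¹).of_nonneg_of_le (fun n => by positivity) fun n => ?_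
  have h1 : ((n : ℝ) + 1) ^ κ ≤ ((n : ℝ) + 1) ^ (⌈κ⌉₊ : ℝ) :=
    Real.rpow_le_rpow_of_exponent_le (by linarith [n.cast_nonneg (α := ℝ)]) (Nat.le_ceil κ)
  rw [Real.rpow_natCast] at h1
  calc _ ≤ ((n : ℝ) + 1) ^ ⌈κ⌉₊ * r ^ n := by gcongr
    _ = _ := by
      push_cast
      field_simp
      ring

lemma blockBound_pow {A : HE β →L[ℝ] HE β} {r L κ : ℝ} (hr : 0 < r) (hL : 0 ≤ L) (hκ : 1 ≤ κ)
    (hA : ∀ v, ‖A v‖ ≤ r * ‖v‖)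
    (htail : ∀ (τ : ℤ) (b m : ℝ) (v w : HE β), 0 ≤ b → 0 < m →
      (∀ s : ℤ, b < |(s : ℝ) - τ| → v s = 0) → (∀ s : ℤ, |(s : ℝ) - τ| ≤ b + m → w s = 0) →
      |inner ℝ w (A v)| ≤ r * (L * m ^ (-(κ - 1))) * ‖w‖ * ‖v‖) (t τ : ℤ) (n : ℕ) :
    BlockBound (A ^ n) t τ ((1 + L) * polyWeight (κ - 1) t τ * (((n : ℝ) + 1) ^ κ * r ^ n)) := by
  intro x y
  have hn1 : (1 : ℝ) ≤ (n : ℝ) + 1 := by linarith [n.cast_nonneg (α := ℝ)]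
  have hn0 : (0 : ℝ) < (n : ℝ) + 1 := by linarith
  by_cases hne : t = τ
  · subst hne
    rw [polyWeight_self]
    have h1 : (1 : ℝ) ≤ ((n : ℝ) + 1) ^ κ := Real.one_le_rpow hn1 (by linarith)
    calc _ ≤ ‖sqSingle t x‖ * ‖(A ^ n) (sqSingle t y)‖ := abs_real_inner_le_norm _ _
      _ ≤ ‖x‖ * (r ^ n * ‖y‖) := by
        rw [norm_sqSingle]
        have := norm_pow_apply_le hr.le hA n (sqSingle t y)
        rw [norm_sqSingle] at this
        gcongr
      _ = 1 * (1 * r ^ n) * ‖x‖ * ‖y‖ := by ring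
      _ ≤ _ := by
        gcongr
        linarith
  · set R : ℝ := |(t : ℝ) - τ| with hR
    have hR1 : 1 ≤ R := by
      rw [hR, ← Int.cast_sub, ← Int.cast_abs]
      exact_mod_cast Int.one_le_abs (sub_ne_zero.2 hne)
    have hR0 : 0 < R := by linarith
    have hm : 0 < R / (n + 1) := by positivity
    obtain ⟨u, z, huz, hsupp, -, hz⟩ := exists_pow_apply_split hr.le
      (T := L * (R / (n + 1)) ^ (-(κ - 1))) (by positivity) hm.le τ hA
      (fun b v w hb => htail τ b _ v w hb hm) y n
    have hut : u t = 0 := hsupp t (by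
      rw [← hR, ← mul_div_assoc, div_lt_iff₀ hn0]
      nlinarith)
    have hw : polyWeight (κ - 1) t τ = R ^ (-(κ - 1)) := by
      rw [polyWeight, gu, ← hR, max_eq_right hR1]
    have hT : (R / (n + 1)) ^ (-(κ - 1)) = R ^ (-(κ - 1)) * ((n : ℝ) + 1) ^ (κ - 1) := by
      rw [Real.div_rpow hR0.le hn0.le, Real.rpow_neg hn0.le, div_inv_eq_mul]
    have hpow : (n : ℝ) * ((n : ℝ) + 1) ^ (κ - 1) ≤ ((n : ℝ) + 1) ^ κ := by
      have : ((n : ℝ) + 1) ^ κ = ((n : ℝ) + 1) * ((n : ℝ) + 1) ^ (κ - 1) := by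
        rw [← Real.rpow_one_add' hn0.le (by linarith)]
        ring_nf
      rw [this]
      gcongr
      linarith
    rw [huz, inner_add_right, lp.inner_single_left (f := u), hut, inner_zero_right, zero_add, hw]
    calc _ ≤ ‖sqSingle t x‖ * ‖z‖ := abs_real_inner_le_norm _ _
      _ ≤ ‖x‖ * (n * r ^ n * (L * (R / (n + 1)) ^ (-(κ - 1))) * ‖y‖) := by
        rw [norm_sqSingle]; gcongr
      _ = L * R ^ (-(κ - 1)) * ((n * ((n : ℝ) + 1) ^ (κ - 1)) * r ^ n) * ‖x‖ * ‖y‖ := by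
        rw [hT]; ring
      _ ≤ _ := by
        gcongr
        linarith

lemma eq_sum_pow_add {A E : HE β →L[ℝ] HE β} {μ : ℝ}
    (h : A.comp E = ContinuousLinearMap.id ℝ _) (n : ℕ) :
    E = (∑ i ∈ Finset.range n, μ • (ContinuousLinearMap.id ℝ (HE β) - μ • A) ^ i) +
      (ContinuousLinearMap.id ℝ (HE β) - μ • A) ^ n * E := by
  induction n with
  | zero => simp
  | succ n ih =>
    set B := ContinuousLinearMap.id ℝ (HE β) - μ • A with hB
    have h1 : E = μ • 1 + B * E := by
      have : A * E = 1 := h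
      rw [hB, sub_mul, smul_mul_assoc, this]
      change E = μ • 1 + (1 * E - μ • 1)
      rw [one_mul]; abel
    rw [Finset.sum_range_succ, add_assoc]
    refine ih.trans (congrArg _ ?_)
    conv_lhs => rw [h1]
    rw [mul_add, mul_smul_comm, mul_one, pow_succ, mul_assoc]

/-- Polynomial decay of the inverse of a coercive operator with polynomially decaying blocks, with
constants independent of the operator and of the block size. -/
lemma exists_blockBound_inverse (K κ lam : ℝ) (hK : 0 ≤ K) (hκ : 2 ≤ κ) (hlam : 0 < lam) :
    ∃ c : ℝ, 0 ≤ c ∧ ∀ (β : Type) [Fintype β] (A E : HE β →L[ℝ] HE β),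
      (∀ s τ, BlockBound A s τ (K * polyWeight κ s τ)) →
      (∀ v, lam * ‖v‖ ^ 2 ≤ inner ℝ v (A v)) → A.comp E = ContinuousLinearMap.id ℝ _ →
      ∀ s τ, BlockBound E s τ (c * polyWeight (κ - 1) s τ) := by
  have hws := weightSum_nonneg κ
  set M : ℝ := K * weightSum κ + 2 * lam with hM
  have hlM : lam < M := by
    have : 0 ≤ K * weightSum κ := by positivity
    linarith
  have hM0 : 0 < M := hlam.trans hlM
  set μ : ℝ := lam / M ^ 2 with hμ
  have hμ0 : 0 < μ := by positivity
  set r : ℝ := √(1 - lam ^ 2 / M ^ 2) with hr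
  have hr0 : 0 < r := by
    refine Real.sqrt_pos.2 (sub_pos.2 ((div_lt_one (by positivity)).2 ?_))
    gcongr
  have hr1 : r < 1 := by
    rw [hr, Real.sqrt_lt' one_pos]
    have : 0 < lam ^ 2 / M ^ 2 := by positivity
    linarith
  set L : ℝ := μ * (K * (2 * κ)) / r with hL
  have hL0 : 0 ≤ L := by positivity
  set D : ℝ := ∑' n : ℕ, ((n : ℝ) + 1) ^ κ * r ^ n with hD
  have hsum := summable_rpow_mul_geometric hr0 hr1 κ
  have hD0 : 0 ≤ D := tsum_nonneg fun n => by positivity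
  refine ⟨μ * (1 + L) * D, by positivity, fun β _ A E hA hlow hinv s τ x y => ?_⟩
  have hnorm : ∀ v, ‖A v‖ ≤ M * ‖v‖ := fun v =>
    (norm_apply_le_of_blockBound hK (by linarith) hA v).trans (by gcongr; linarith)
  have hB := norm_sub_smul_apply_le hlam hlM hlow hnorm
  rw [← hμ, ← hr] at hB
  have htail : ∀ (τ : ℤ) (b m : ℝ) (v w : HE β), 0 ≤ b → 0 < m →
      (∀ s : ℤ, b < |(s : ℝ) - τ| → v s = 0) → (∀ s : ℤ, |(s : ℝ) - τ| ≤ b + m → w s = 0) →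
      |inner ℝ w ((ContinuousLinearMap.id ℝ (HE β) - μ • A) v)| ≤
        r * (L * m ^ (-(κ - 1))) * ‖w‖ * ‖v‖ := by
    intro τ b m v w hb hm hv hw
    have h0 : inner ℝ w v = 0 := by
      rw [lp.inner_eq_tsum]
      refine (tsum_congr fun k => ?_).trans tsum_zero
      rcases le_or_gt (|(k : ℝ) - τ|) b with hk | hk
      · rw [hw k (by linarith), inner_zero_left]
      · rw [hv k hk, inner_zero_right]
    rw [sub_apply, smul_apply, ContinuousLinearMap.id_apply, inner_sub_right, h0, zero_sub,
      abs_neg, real_inner_smul_right, abs_mul, abs_of_pos hμ0]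
    calc _ ≤ μ * (K * (2 * (κ * m ^ (-(κ - 1)))) * ‖w‖ * ‖v‖) := by
          gcongr
          exact abs_inner_apply_le_of_separated hK hκ hm hA τ v w hv hw
      _ = _ := by rw [hL]; field_simp
  have hpow := blockBound_pow hr0 hL0 (by linarith) hB htail s τ
  have hbound : ∀ n : ℕ, |inner ℝ (sqSingle s x) (E (sqSingle τ y))| ≤
      μ * (1 + L) * D * polyWeight (κ - 1) s τ * ‖x‖ * ‖y‖ +
        ‖x‖ * (r ^ n * ‖E (sqSingle τ y)‖) := by
    intro n
    have hE := congrArg (fun T : HE β →L[ℝ] HE β => T (sqSingle τ y))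
      (eq_sum_pow_add (μ := μ) hinv n)
    simp only [add_apply, sum_apply, smul_apply,
      mul_apply_eq_comp] at hE
    rw [hE, inner_add_right, inner_sum, ← hE]
    refine (abs_add_le _ _).trans (add_le_add ?_ ?_)
    · have hw := polyWeight_nonneg (κ - 1) s τ
      calc _ ≤ ∑ i ∈ Finset.range n, μ * ((1 + L) * polyWeight (κ - 1) s τ *
              (((i : ℝ) + 1) ^ κ * r ^ i) * ‖x‖ * ‖y‖) := by
            refine (Finset.abs_sum_le_sum_abs _ _).trans (Finset.sum_le_sum fun i _ => ?_)
            rw [real_inner_smul_right, abs_mul, abs_of_pos hμ0]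
            gcongr
            exact hpow i x y
        _ = μ * (1 + L) * polyWeight (κ - 1) s τ * ‖x‖ * ‖y‖ *
              ∑ i ∈ Finset.range n, (((i : ℝ) + 1) ^ κ * r ^ i) := by
            rw [Finset.mul_sum]
            exact Finset.sum_congr rfl fun i _ => by ring
        _ ≤ μ * (1 + L) * polyWeight (κ - 1) s τ * ‖x‖ * ‖y‖ * D := by
            gcongr
            exact hsum.sum_le_tsum _ fun i _ => by positivity
        _ = _ := by ring
    · refine (abs_real_inner_le_norm _ _).trans ?_
      rw [norm_sqSingle]
      gcongr
      exact norm_pow_apply_le hr0.le hB n _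
  have hlim : Tendsto (fun n : ℕ => μ * (1 + L) * D * polyWeight (κ - 1) s τ * ‖x‖ * ‖y‖ +
      ‖x‖ * (r ^ n * ‖E (sqSingle τ y)‖)) atTop
      (𝓝 (μ * (1 + L) * D * polyWeight (κ - 1) s τ * ‖x‖ * ‖y‖ +
        ‖x‖ * (0 * ‖E (sqSingle τ y)‖))) :=
    tendsto_const_nhds.add
      (((tendsto_pow_atTop_nhds_zero_of_lt_one hr0.le hr1).mul_const _).const_mul _)
  rw [zero_mul, mul_zero, add_zero] at hlim
  exact ge_of_tendsto' hlim hbound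

end InverseDecay

section SchurComplement

lemma BlockBound.comp_polyWeight {α β γ : Type} [Fintype α] [Fintype β] [Fintype γ]
    {A : HE β →L[ℝ] HE α} {B : HE γ →L[ℝ] HE β} {a c d : ℝ} {s τ : ℤ} (ha : 1 < a) (hc : 0 ≤ c)
    (hd : 0 ≤ d) (hA : ∀ k, BlockBound A s k (c * polyWeight a s k))
    (hB : ∀ k, BlockBound B k τ (d * polyWeight a k τ)) :
    BlockBound (A.comp B) s τ (c * d * convConst a * polyWeight a s τ) := by
  refine BlockBound.comp hA hB (fun k => mul_nonneg hc (polyWeight_nonneg _ _ _))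
    (fun k => mul_nonneg hd (polyWeight_nonneg _ _ _)) fun F => ?_
  calc _ = c * d * ∑ k ∈ F, polyWeight a s k * polyWeight a k τ := by
        rw [Finset.mul_sum]
        exact Finset.sum_congr rfl fun k _ => by ring
    _ ≤ c * d * (convConst a * polyWeight a s τ) := by
        gcongr
        exact sum_polyWeight_mul_le ha s τ F
    _ = _ := by ring

variable {β : Type} [Fintype β]

lemma schurComplement_sub_eq {A B E F : HE β →L[ℝ] HE β} {Caa Taa : HE (Fin 1) →L[ℝ] HE (Fin 1)}
    {P Q : HE β →L[ℝ] HE (Fin 1)} (hAE : A.comp E = ContinuousLinearMap.id ℝ _)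
    (hFB : F.comp B = ContinuousLinearMap.id ℝ _) :
    (Caa - P.comp (E.comp (ContinuousLinearMap.adjoint P))) -
        (Taa - Q.comp (F.comp (ContinuousLinearMap.adjoint Q))) =
      (Caa - Taa) - (P - Q).comp (E.comp (ContinuousLinearMap.adjoint P)) +
        ((Q.comp F).comp (A - B)).comp (E.comp (ContinuousLinearMap.adjoint P)) -
        (Q.comp F).comp (ContinuousLinearMap.adjoint (P - Q)) := by
  have hAE' : ∀ v, A (E v) = v := fun v => congrArg (fun T => T v) hAE
  have hFB' : ∀ v, F (B v) = v := fun v => congrArg (fun T => T v) hFB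
  refine ContinuousLinearMap.ext fun v => ?_
  simp only [map_sub, sub_apply, add_apply, ContinuousLinearMap.comp_apply, hAE', hFB']
  abel

/-- Perturbation bound for Schur complements, localised at the row `t`. -/
lemma blockBound_schurComplement_sub {A B E F : HE β →L[ℝ] HE β}
    {Caa Taa : HE (Fin 1) →L[ℝ] HE (Fin 1)} {P Q : HE β →L[ℝ] HE (Fin 1)} {a θ c d : ℝ} {t : ℤ}
    (hθ : 0 ≤ θ) (haθ : 1 < a - θ) (hc : 0 ≤ c) (hd : 0 ≤ d)
    (hAE : A.comp E = ContinuousLinearMap.id ℝ _) (hFB : F.comp B = ContinuousLinearMap.id ℝ _)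
    (hP : ∀ s τ, BlockBound P s τ (c * polyWeight a s τ))
    (hQ : ∀ s τ, BlockBound Q s τ (c * polyWeight a s τ))
    (hE : ∀ s τ, BlockBound E s τ (c * polyWeight a s τ))
    (hF : ∀ s τ, BlockBound F s τ (c * polyWeight a s τ))
    (hCT : ∀ s τ, BlockBound (Caa - Taa) s τ (d * (gu ((s : ℝ) - t) ^ θ * polyWeight a s τ)))
    (hPQ : ∀ s τ, BlockBound (P - Q) s τ (d * (gu ((s : ℝ) - t) ^ θ * polyWeight a s τ)))
    (hPQ' : ∀ s τ, BlockBound (P - Q) τ s (d * (gu ((s : ℝ) - t) ^ θ * polyWeight a s τ)))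
    (hAB : ∀ s τ, BlockBound (A - B) s τ (d * (gu ((s : ℝ) - t) ^ θ * polyWeight a s τ))) (τ : ℤ) :
    BlockBound ((Caa - P.comp (E.comp (ContinuousLinearMap.adjoint P))) -
        (Taa - Q.comp (F.comp (ContinuousLinearMap.adjoint Q)))) t τ
      ((1 + c ^ 2 * convConst (a - θ) ^ 2 +
        c ^ 4 * convConst a * convConst (a - θ) ^ 3 + c ^ 2 * convConst a * convConst (a - θ)) * d *
        polyWeight (a - θ) t τ) := by
  have ha : 1 < a := by linarith
  have hV := convConst_nonneg (a - θ)
  have hVa := convConst_nonneg a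
  have hanti : ∀ s τ, polyWeight a s τ ≤ polyWeight (a - θ) s τ :=
    polyWeight_anti (by linarith)
  have hrow : ∀ τ, gu ((t : ℝ) - t) ^ θ * polyWeight a t τ ≤ polyWeight (a - θ) t τ := fun τ => by
    rw [sub_self, gu_zero, Real.one_rpow, one_mul]
    exact hanti t τ
  have hEP : ∀ s τ, BlockBound (E.comp (ContinuousLinearMap.adjoint P)) s τ
      (c * c * convConst (a - θ) * polyWeight (a - θ) s τ) := fun s τ =>
    BlockBound.comp_polyWeight haθ hc hc
      (fun k => (hE s k).mono (mul_le_mul_of_nonneg_left (hanti s k) hc))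
      (fun k => (hP τ k).adjoint.mono (by
        rw [polyWeight_comm]; exact mul_le_mul_of_nonneg_left (hanti k τ) hc))
  have hQF : ∀ s τ, BlockBound (Q.comp F) s τ (c * c * convConst a * polyWeight a s τ) :=
    fun s τ => BlockBound.comp_polyWeight ha hc hc (hQ s) (fun k => hF k τ)
  have hloc : ∀ {δ : Type} [Fintype δ] (X : HE δ →L[ℝ] HE β),
      (∀ s τ, BlockBound X s τ (d * (gu ((s : ℝ) - t) ^ θ * polyWeight a s τ))) →
      ∀ τ, BlockBound ((Q.comp F).comp X) t τ
        (c * c * convConst a * d * convConst (a - θ) * polyWeight (a - θ) t τ) := by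
    intro δ _ X hX τ
    refine BlockBound.comp (hQF t) (fun k => hX k τ)
      (fun k => mul_nonneg (by positivity) (polyWeight_nonneg _ _ _))
      (fun k => mul_nonneg hd (mul_nonneg (Real.rpow_nonneg (gu_pos _).le _)
        (polyWeight_nonneg _ _ _))) fun G => ?_
    calc _ ≤ ∑ k ∈ G, c * c * convConst a * d *
            (polyWeight (a - θ) t k * polyWeight (a - θ) k τ) := by
          refine Finset.sum_le_sum fun k _ => ?_
          have h1 : gu ((k : ℝ) - t) ^ θ * polyWeight a t k = polyWeight (a - θ) t k := by
            rw [gu_sub_comm, gu_rpow_mul_polyWeight]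
          have h2 : 0 ≤ polyWeight (a - θ) t k := polyWeight_nonneg _ _ _
          calc _ = c * c * convConst a * d *
                (gu ((k : ℝ) - t) ^ θ * polyWeight a t k * polyWeight a k τ) := by ring
            _ ≤ _ := by
              rw [h1]
              gcongr
              exact hanti k τ
      _ ≤ c * c * convConst a * d * (convConst (a - θ) * polyWeight (a - θ) t τ) := by
          rw [← Finset.mul_sum]
          gcongr
          exact sum_polyWeight_mul_le haθ t τ G
      _ = _ := by ring
  have hadj : ∀ s τ, BlockBound (ContinuousLinearMap.adjoint (P - Q)) s τ
      (d * (gu ((s : ℝ) - t) ^ θ * polyWeight a s τ)) := fun s τ => (hPQ' s τ).adjoint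
  have h1 : BlockBound (Caa - Taa) t τ (d * polyWeight (a - θ) t τ) :=
    (hCT t τ).mono (mul_le_mul_of_nonneg_left (hrow τ) hd)
  have h2 := BlockBound.comp_polyWeight (A := P - Q) (s := t) (τ := τ) haθ hd
    (by positivity : 0 ≤ c * c * convConst (a - θ))
    (fun k => (hPQ t k).mono (mul_le_mul_of_nonneg_left (hrow k) hd)) (fun k => hEP k τ)
  have h3 := BlockBound.comp_polyWeight (s := t) (τ := τ) haθ
    (by positivity : 0 ≤ c * c * convConst a * d * convConst (a - θ))
    (by positivity : 0 ≤ c * c * convConst (a - θ)) (hloc (A - B) hAB) (fun k => hEP k τ)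
  have h4 := hloc _ hadj τ
  rw [schurComplement_sub_eq hAE hFB]
  exact (((h1.sub h2).add h3).sub h4).mono (le_of_eq (by ring))

lemma abs_inner_bvE_le {X : HE (Fin 1) →L[ℝ] HE (Fin 1)} {t τ : ℤ} {c : ℝ}
    (h : BlockBound X t τ c) : |inner ℝ (bvE t (0 : Fin 1)) (X (bvE τ (0 : Fin 1)))| ≤ c := by
  have := h (EuclideanSpace.single 0 1) (EuclideanSpace.single 0 1)
  simpa [bvE] using this

/-- The operators entering the Schur complement of the component `a`, with entries taken from the
block matrix `M`. -/
structure PartialSystem {p : ℕ} (a : Fin p) (M : ℤ → ℤ → Matrix (Fin p) (Fin p) ℝ)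
    (Caa : HE (Fin 1) →L[ℝ] HE (Fin 1)) (P : HE {c : Fin p // c ≠ a} →L[ℝ] HE (Fin 1))
    (A E : HE {c : Fin p // c ≠ a} →L[ℝ] HE {c : Fin p // c ≠ a}) : Prop where
  entry_aa : ∀ (s τ : ℤ) (i j : Fin 1), entE Caa s τ i j = M s τ a a
  entry_aS : ∀ (s τ : ℤ) (i : Fin 1) (c : {c : Fin p // c ≠ a}), entE P s τ i c = M s τ a c
  entry_SS : ∀ (s τ : ℤ) (c c' : {c : Fin p // c ≠ a}), entE A s τ c c' = M s τ c c'
  comp_inv : A.comp E = ContinuousLinearMap.id ℝ _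
  inv_comp : E.comp A = ContinuousLinearMap.id ℝ _

/-- Coercivity of the quadratic form with blocks `M`, on finitely supported sequences. -/
def BlockCoercive {p : ℕ} (M : ℤ → ℤ → Matrix (Fin p) (Fin p) ℝ) (lam : ℝ) : Prop :=
  ∀ (F : Finset ℤ) (z : ℤ → EuclideanSpace ℝ (Fin p)), lam * ∑ s ∈ F, ‖z s‖ ^ 2 ≤
    ∑ s ∈ F, ∑ τ ∈ F, inner ℝ (z s) (Matrix.toEuclideanLin (M s τ) (z τ))

lemma PartialSystem.lower_bound {p : ℕ} {a : Fin p} {M : ℤ → ℤ → Matrix (Fin p) (Fin p) ℝ}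
    {Caa : HE (Fin 1) →L[ℝ] HE (Fin 1)} {P : HE {c : Fin p // c ≠ a} →L[ℝ] HE (Fin 1)}
    {A E : HE {c : Fin p // c ≠ a} →L[ℝ] HE {c : Fin p // c ≠ a}}
    (h : PartialSystem a M Caa P A E) {lam : ℝ} (hM : BlockCoercive M lam)
    (v : HE {c : Fin p // c ≠ a}) : lam * ‖v‖ ^ 2 ≤ inner ℝ v (A v) := by
  refine lower_bound_of_finset (fun F z => ?_) v
  have := hM F fun s => spread Subtype.val (z s)
  simp only [norm_spread Subtype.val_injective] at this
  refine this.trans (le_of_eq ?_)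
  exact Finset.sum_congr rfl fun s _ => Finset.sum_congr rfl fun τ _ =>
    (inner_sqSingle_apply_eq (h.entry_SS s τ) (z s) (z τ)).symm

lemma exists_schurEnt_bounds (K κ lam θ : ℝ) (hK : 0 ≤ K) (hκ : 3 < κ) (hlam : 0 < lam)
    (hθ0 : 0 ≤ θ) (hθ1 : θ ≤ 1) :
    ∃ Λ : ℝ, 0 ≤ Λ ∧ ∀ (p : ℕ) (a : Fin p) (M N : ℤ → ℤ → Matrix (Fin p) (Fin p) ℝ)
      (Caa Taa : HE (Fin 1) →L[ℝ] HE (Fin 1)) (P Q : HE {c : Fin p // c ≠ a} →L[ℝ] HE (Fin 1))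
      (A B E F : HE {c : Fin p // c ≠ a} →L[ℝ] HE {c : Fin p // c ≠ a}),
      PartialSystem a M Caa P A E → PartialSystem a N Taa Q B F →
      BlockCoercive M lam → BlockCoercive N lam →
      (∀ s τ, specNorm (M s τ) ≤ K * polyWeight κ s τ) →
      (∀ s τ, specNorm (N s τ) ≤ K * polyWeight κ s τ) →
      ∀ t τ : ℤ,
        |schurEnt Caa P E t τ| ≤ Λ * polyWeight (κ - 1) t τ ∧
        |schurEnt Taa Q F t τ| ≤ Λ * polyWeight (κ - 1) t τ ∧
        ∀ d : ℝ, 0 ≤ d →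
          (∀ s σ, specNorm (M s σ - N s σ) ≤
            d * (gu ((s : ℝ) - t) ^ θ * polyWeight (κ - 1) s σ)) →
          (∀ s σ, specNorm (M σ s - N σ s) ≤
            d * (gu ((s : ℝ) - t) ^ θ * polyWeight (κ - 1) s σ)) →
          |schurEnt Caa P E t τ - schurEnt Taa Q F t τ| ≤
            Λ * d * polyWeight (κ - 1 - θ) t τ := by
  obtain ⟨c₀, hc₀, hinv⟩ := exists_blockBound_inverse K κ lam hK (by linarith) hlam
  set c : ℝ := K + c₀ with hc_def
  have hc : 0 ≤ c := by positivity
  have hV := convConst_nonneg (κ - 1)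
  have hVθ := convConst_nonneg (κ - 1 - θ)
  set L : ℝ := 1 + c ^ 2 * convConst (κ - 1 - θ) ^ 2 +
    c ^ 4 * convConst (κ - 1) * convConst (κ - 1 - θ) ^ 3 +
    c ^ 2 * convConst (κ - 1) * convConst (κ - 1 - θ) with hL
  set L' : ℝ := c + c * (c * c * convConst (κ - 1)) * convConst (κ - 1) with hL'
  have hL0 : 0 ≤ L := by positivity
  have hL'0 : 0 ≤ L' := by positivity
  refine ⟨L + L', by positivity, ?_⟩
  intro p a M N Caa Taa P Q A B E F hM hN hMc hNc hMb hNb t τ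
  have hone : ∀ x : Fin 1 → Fin p, x.Injective := fun x => Function.injective_of_subsingleton x
  have hsub : (Subtype.val : {c : Fin p // c ≠ a} → Fin p).Injective := Subtype.val_injective
  have hdecay : ∀ {b : ℝ} (s σ : ℤ), b ≤ K * polyWeight κ s σ → b ≤ c * polyWeight (κ - 1) s σ := by
    intro b s σ hb
    refine hb.trans (mul_le_mul (by linarith) (polyWeight_anti (by linarith) s σ)
      (polyWeight_nonneg _ _ _) hc)
  have hbase : ∀ (M : ℤ → ℤ → Matrix (Fin p) (Fin p) ℝ) (Caa : HE (Fin 1) →L[ℝ] HE (Fin 1))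
      (P : HE {c : Fin p // c ≠ a} →L[ℝ] HE (Fin 1))
      (A E : HE {c : Fin p // c ≠ a} →L[ℝ] HE {c : Fin p // c ≠ a}),
      PartialSystem a M Caa P A E → BlockCoercive M lam →
      (∀ s τ, specNorm (M s τ) ≤ K * polyWeight κ s τ) →
      (∀ s σ, BlockBound P s σ (c * polyWeight (κ - 1) s σ)) ∧
      (∀ s σ, BlockBound E s σ (c * polyWeight (κ - 1) s σ)) ∧
      |schurEnt Caa P E t τ| ≤ (L + L') * polyWeight (κ - 1) t τ := by
    intro M Caa P A E h hco hb
    have hP : ∀ s σ, BlockBound P s σ (c * polyWeight (κ - 1) s σ) := fun s σ =>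
      (blockBound_of_entE (f := fun _ => a) (g := Subtype.val) (hone _) hsub
        (h.entry_aS s σ)).mono (hdecay s σ (hb s σ))
    have hE : ∀ s σ, BlockBound E s σ (c * polyWeight (κ - 1) s σ) := fun s σ =>
      (hinv _ A E (fun s σ => (blockBound_of_entE hsub hsub (h.entry_SS s σ)).mono (hb s σ))
        (h.lower_bound hco) h.comp_inv s σ).mono
        (mul_le_mul_of_nonneg_right (by linarith) (polyWeight_nonneg _ _ _))
    have haa : BlockBound Caa t τ (c * polyWeight (κ - 1) t τ) :=
      (blockBound_of_entE (f := fun _ => a) (g := fun _ => a) (hone _) (hone _)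
        (h.entry_aa t τ)).mono (hdecay t τ (hb t τ))
    have hEP : ∀ s σ, BlockBound (E.comp (ContinuousLinearMap.adjoint P)) s σ
        (c * c * convConst (κ - 1) * polyWeight (κ - 1) s σ) := fun s σ =>
      BlockBound.comp_polyWeight (by linarith) hc hc (hE s)
        (fun k => by rw [polyWeight_comm]; exact (hP σ k).adjoint)
    have hPEP := BlockBound.comp_polyWeight (s := t) (τ := τ) (by linarith) hc
      (by positivity : 0 ≤ c * c * convConst (κ - 1)) (hP t) (fun k => hEP k τ)
    refine ⟨hP, hE, abs_inner_bvE_le ((haa.sub hPEP).mono ?_)⟩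
    have hw := polyWeight_nonneg (κ - 1) t τ
    calc _ = L' * polyWeight (κ - 1) t τ := by rw [hL']; ring
      _ ≤ _ := by gcongr; linarith
  obtain ⟨hP, hE, h1⟩ := hbase M Caa P A E hM hMc hMb
  obtain ⟨hQ, hF, h2⟩ := hbase N Taa Q B F hN hNc hNb
  refine ⟨h1, h2, fun d hd hd1 hd2 => ?_⟩
  have haS : ∀ s σ, BlockBound (P - Q) s σ (specNorm (M s σ - N s σ)) := fun s σ =>
    blockBound_of_entE (f := fun _ => a) (g := Subtype.val) (hone _) hsub fun i j => by
      rw [entE_sub, hM.entry_aS, hN.entry_aS, Matrix.sub_apply]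
  have haa : ∀ s σ, BlockBound (Caa - Taa) s σ (specNorm (M s σ - N s σ)) := fun s σ =>
    blockBound_of_entE (f := fun _ => a) (g := fun _ => a) (hone _) (hone _) fun i j => by
      rw [entE_sub, hM.entry_aa, hN.entry_aa, Matrix.sub_apply]
  have hSS : ∀ s σ, BlockBound (A - B) s σ (specNorm (M s σ - N s σ)) := fun s σ =>
    blockBound_of_entE hsub hsub fun i j => by
      rw [entE_sub, hM.entry_SS, hN.entry_SS, Matrix.sub_apply]
  have hmain := blockBound_schurComplement_sub hθ0 (by linarith) hc hd hM.comp_inv hN.inv_comp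
    hP hQ hE hF (fun s σ => (haa s σ).mono (hd1 s σ)) (fun s σ => (haS s σ).mono (hd1 s σ))
    (fun s σ => (haS σ s).mono (hd2 s σ)) (fun s σ => (hSS s σ).mono (hd1 s σ)) τ
  rw [schurEnt, schurEnt, ← inner_sub_right, ← sub_apply]
  refine (abs_inner_bvE_le hmain).trans ?_
  have hw := polyWeight_nonneg (κ - 1 - θ) t τ
  have hLL : L ≤ L + L' := by linarith
  exact mul_le_mul_of_nonneg_right (mul_le_mul_of_nonneg_right hLL hd) hw

end SchurComplement

section LocalStationarity

lemma specNorm_add_le {p : ℕ} (M N : Matrix (Fin p) (Fin p) ℝ) :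
    specNorm (M + N) ≤ specNorm M + specNorm N := by
  simp only [specNorm, map_add]
  exact norm_add_le _ _

variable {p : ℕ} {K κ lamInf lamSup : ℝ} {N₀ : ℕ} {C : ℕ → Hp p →L[ℝ] Hp p}
  {Cr : ℤ → ℝ → Matrix (Fin p) (Fin p) ℝ}

lemma AssumptionLS.nonneg (h : AssumptionLS p K κ lamInf lamSup N₀ C Cr) : 0 ≤ K := by
  have := (specNorm_nonneg _).trans (h.crBound 0 0)
  simpa [gu_zero] using this

lemma AssumptionLS.specNorm_blk_sub_le (h : AssumptionLS p K κ lamInf lamSup N₀ C Cr) {N : ℕ}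
    (hN : 1 ≤ N) (s τ : ℤ) (u : ℝ) :
    specNorm (blk (C N) s τ - Cr (s - τ) u) ≤
      K * polyWeight (κ - 1) s τ * (1 / N) + K * |(s : ℝ) / N - u| * polyWeight κ s τ := by
  have h1 := h.approx N hN s τ
  have h2 := h.crLip (s - τ) ((s : ℝ) / N) u
  rw [← sub_add_sub_cancel _ (Cr (s - τ) ((s : ℝ) / N)) _]
  refine (specNorm_add_le _ _).trans (add_le_add (h1.trans ?_) (h2.trans_eq ?_))
  · have hw : gu ((s : ℝ) - τ) ^ (-κ + 1) = polyWeight (κ - 1) s τ := by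
      rw [polyWeight]; ring_nf
    rw [hw]
    have := h.nonneg
    have := polyWeight_nonneg (κ - 1) s τ
    gcongr
    exact min_le_left _ _
  · simp [polyWeight]

lemma AssumptionLS.blockCoercive_blk (h : AssumptionLS p K κ lamInf lamSup N₀ C Cr) {N : ℕ}
    (hN : N₀ ≤ N) : BlockCoercive (blk (C N)) lamInf := fun F z => by
  simpa using lower_bound_shift (h.lower N hN) 0 F z

lemma AssumptionLS.blockCoercive_toeplitz (h : AssumptionLS p K κ lamInf lamSup N₀ C Cr)
    (hκ : 1 ≤ κ) (u : ℝ) : BlockCoercive (fun s τ => Cr (s - τ) u) lamInf := by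
  intro F z
  have hK := h.nonneg
  have hlim : ∀ s τ : ℤ, Tendsto (fun N : ℕ => inner ℝ (z s) (Matrix.toEuclideanLin
      (blk (C N) (s + ⌊u * N⌋) (τ + ⌊u * N⌋)) (z τ))) atTop
      (𝓝 (inner ℝ (z s) (Matrix.toEuclideanLin (Cr (s - τ) u) (z τ)))) := by
    intro s τ
    rw [tendsto_iff_norm_sub_tendsto_zero]
    have hz : Tendsto (fun N : ℕ => K * (|(s : ℝ)| + 2) * ‖z s‖ * ‖z τ‖ * (1 / (N : ℝ))) atTop
        (𝓝 0) := by
      simpa using tendsto_one_div_atTop_nhds_zero_nat.const_mul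
        (K * (|(s : ℝ)| + 2) * ‖z s‖ * ‖z τ‖)
    refine squeeze_zero' (Eventually.of_forall fun N => norm_nonneg _) ?_ hz
    filter_upwards [eventually_ge_atTop 1] with N hN
    have hN0 : (0 : ℝ) < N := by exact_mod_cast hN
    have h1 := h.specNorm_blk_sub_le hN (s + ⌊u * N⌋) (τ + ⌊u * N⌋) u
    rw [add_sub_add_right_eq_sub] at h1
    have hw : ∀ b : ℝ, 0 ≤ b → polyWeight b (s + ⌊u * N⌋) (τ + ⌊u * N⌋) ≤ 1 := fun b hb =>
      Real.rpow_le_one_of_one_le_of_nonpos (one_le_gu _) (by linarith)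
    have h2 : |((s + ⌊u * N⌋ : ℤ) : ℝ) / N - u| ≤ (|(s : ℝ)| + 1) * (1 / N) := by
      rw [div_sub' hN0.ne', abs_div, abs_of_pos hN0, div_eq_mul_one_div]
      gcongr
      have h3 := Int.floor_le (u * N)
      have h4 := Int.lt_floor_add_one (u * N)
      push_cast
      rw [abs_le]
      constructor <;> linarith [le_abs_self (s : ℝ), neg_abs_le (s : ℝ)]
    have h5 : specNorm (blk (C N) (s + ⌊u * N⌋) (τ + ⌊u * N⌋) - Cr (s - τ) u) ≤
        K * (|(s : ℝ)| + 2) * (1 / N) := by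
      calc _ ≤ K * 1 * (1 / N) + K * ((|(s : ℝ)| + 1) * (1 / N)) * 1 := by
            have hw1 := hw (κ - 1) (by linarith)
            have hw2 := hw κ (by linarith)
            refine h1.trans ?_
            gcongr
            exact polyWeight_nonneg _ _ _
        _ = _ := by ring
    rw [← inner_sub_right, ← LinearMap.sub_apply, ← map_sub, Real.norm_eq_abs]
    refine (abs_inner_toEuclideanLin_le _ _ _).trans ?_
    calc _ ≤ K * (|(s : ℝ)| + 2) * (1 / N) * ‖z s‖ * ‖z τ‖ := by gcongr
      _ = _ := by ring
  refine ge_of_tendsto (tendsto_finsetSum F fun s _ => tendsto_finsetSum F fun τ _ => hlim s τ) ?_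
  filter_upwards [eventually_ge_atTop N₀] with N hN
  exact lower_bound_shift (h.lower N hN) ⌊u * N⌋ F z

lemma AssumptionLS.specNorm_toeplitz_le (h : AssumptionLS p K κ lamInf lamSup N₀ C Cr) (u : ℝ)
    (s τ : ℤ) : specNorm (Cr (s - τ) u) ≤ K * polyWeight κ s τ := by
  simpa [polyWeight] using h.crBound (s - τ) u

lemma AssumptionLS.specNorm_blk_sub_toeplitz_le (h : AssumptionLS p K κ lamInf lamSup N₀ C Cr)
    {N : ℕ} (hN : 1 ≤ N) (t s τ : ℤ) :
    specNorm (blk (C N) s τ - Cr (s - τ) ((t : ℝ) / N)) ≤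
        3 * K * (1 / N) * (gu ((s : ℝ) - t) ^ (1 : ℝ) * polyWeight (κ - 1) s τ) ∧
      specNorm (blk (C N) τ s - Cr (τ - s) ((t : ℝ) / N)) ≤
        3 * K * (1 / N) * (gu ((s : ℝ) - t) ^ (1 : ℝ) * polyWeight (κ - 1) s τ) := by
  have hK := h.nonneg
  have hN0 : (0 : ℝ) < N := by exact_mod_cast hN
  rw [Real.rpow_one]
  have hg := one_le_gu ((s : ℝ) - t)
  have hw0 := polyWeight_nonneg (κ - 1) s τ
  have hw1 : polyWeight κ s τ ≤ polyWeight (κ - 1) s τ := polyWeight_anti (by linarith) s τ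
  have hq : ∀ x : ℤ, |(x : ℝ) / N - t / N| = |(x : ℝ) - t| * (1 / N) := fun x => by
    rw [← sub_div, abs_div, abs_of_pos hN0, div_eq_mul_one_div]
  have hwg : gu ((s : ℝ) - τ) * polyWeight κ s τ = polyWeight (κ - 1) s τ := by
    simpa using gu_rpow_mul_polyWeight κ 1 s τ
  have hKN : 0 ≤ K * (1 / (N : ℝ)) := by positivity
  have hprod : polyWeight (κ - 1) s τ ≤ gu ((s : ℝ) - t) * polyWeight (κ - 1) s τ :=
    le_mul_of_one_le_left hw0 hg
  have hwκ := polyWeight_nonneg κ s τ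
  constructor
  · refine (h.specNorm_blk_sub_le hN s τ _).trans ?_
    rw [hq]
    have h1 : |(s : ℝ) - t| * polyWeight κ s τ ≤ gu ((s : ℝ) - t) * polyWeight (κ - 1) s τ :=
      mul_le_mul (abs_le_gu _) hw1 hwκ (by linarith)
    have h2 : 0 ≤ gu ((s : ℝ) - t) * polyWeight (κ - 1) s τ := hw0.trans hprod
    calc _ = K * (1 / N) * (polyWeight (κ - 1) s τ + |(s : ℝ) - t| * polyWeight κ s τ) := by ring
      _ ≤ K * (1 / N) * (3 * (gu ((s : ℝ) - t) * polyWeight (κ - 1) s τ)) := by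
          gcongr
          linarith
      _ = _ := by ring
  · refine (h.specNorm_blk_sub_le hN τ s _).trans ?_
    rw [hq, polyWeight_comm _ τ s, polyWeight_comm _ τ s]
    have h3 : |(τ : ℝ) - t| ≤ 2 * (gu ((s : ℝ) - t) * gu ((s : ℝ) - τ)) := by
      have h4 := gu_add_le ((τ : ℝ) - s) (s - t)
      rw [sub_add_sub_cancel, gu_sub_comm (τ : ℝ) s] at h4
      have h5 := one_le_gu ((s : ℝ) - τ)
      nlinarith [abs_le_gu ((τ : ℝ) - t)]
    calc _ = K * (1 / N) * (polyWeight (κ - 1) s τ + |(τ : ℝ) - t| * polyWeight κ s τ) := by ring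
      _ ≤ K * (1 / N) * (gu ((s : ℝ) - t) * polyWeight (κ - 1) s τ +
            2 * (gu ((s : ℝ) - t) * gu ((s : ℝ) - τ)) * polyWeight κ s τ) := by gcongr
      _ = K * (1 / N) * (gu ((s : ℝ) - t) * polyWeight (κ - 1) s τ +
            2 * (gu ((s : ℝ) - t) * (gu ((s : ℝ) - τ) * polyWeight κ s τ))) := by ring
      _ = _ := by rw [hwg]; ring

lemma polyWeight_le_zeta_rpow {b : ℝ} (hb : 0 ≤ b) (t τ : ℤ) :
    polyWeight b t τ ≤ zeta ((t : ℝ) - τ) ^ b := by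
  have hg := gu_pos ((t : ℝ) - τ)
  rw [polyWeight, Real.rpow_neg hg.le, ← Real.inv_rpow hg.le]
  refine Real.rpow_le_rpow (by positivity) ?_ hb
  rw [zeta, inv_eq_one_div]
  gcongr
  exact le_max_left _ _

lemma zeta_pos (x : ℝ) : 0 < zeta x :=
  div_pos (one_pos.trans_le (le_max_left _ _)) (gu_pos x)

end LocalStationarity

/-- Theorem 3.7, bounds (3.12) and (3.13): smoothness of the self partial covariance
`ρ^{(a,a)|−{a}}`.  Sub-operators are characterised by their scalar entries taken from
`𝐂^(N)` (resp. from the Toeplitz family `C_r(u)`), and `E` denotes the inverse of the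
compression `𝐂_{S′,S′}` with `S′ = {1,…,p}∖{a}`. -/
theorem self_partial_covariance_smooth (K κ lamInf lamSup : ℝ) (N₀ : ℕ)
    (hκ : 3 < κ) (hInf : 0 < lamInf) (hle : lamInf ≤ lamSup) :
    ∃ 𝒦 : ℝ, 0 < 𝒦 ∧
      ∀ (p : ℕ), 2 ≤ p →
        ∀ (C : ℕ → Hp p →L[ℝ] Hp p) (Cr : ℤ → ℝ → Matrix (Fin p) (Fin p) ℝ),
          AssumptionLS p K κ lamInf lamSup N₀ C Cr →
          ∀ a : Fin p,
            ∀ N : ℕ, N₀ ≤ N → 1 ≤ N →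
              ∀ (Caa : HE (Fin 1) →L[ℝ] HE (Fin 1))
                (CaSp : HE {c : Fin p // c ≠ a} →L[ℝ] HE (Fin 1))
                (CSpSp E : HE {c : Fin p // c ≠ a} →L[ℝ] HE {c : Fin p // c ≠ a}),
                (∀ (t τ : ℤ) (i j : Fin 1), entE Caa t τ i j = blk (C N) t τ a a) →
                (∀ (t τ : ℤ) (i : Fin 1) (c : {c : Fin p // c ≠ a}),
                  entE CaSp t τ i c = blk (C N) t τ a (c : Fin p)) →
                (∀ (t τ : ℤ) (c c' : {c : Fin p // c ≠ a}),
                  entE CSpSp t τ c c' = blk (C N) t τ (c : Fin p) (c' : Fin p)) →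
                CSpSp.comp E = ContinuousLinearMap.id ℝ _ →
                E.comp CSpSp = ContinuousLinearMap.id ℝ _ →
                -- (3.12): local approximation at `u = t/N`
                (∀ (t τ : ℤ)
                  (Taa : HE (Fin 1) →L[ℝ] HE (Fin 1))
                  (TaSp : HE {c : Fin p // c ≠ a} →L[ℝ] HE (Fin 1))
                  (TSpSp F : HE {c : Fin p // c ≠ a} →L[ℝ] HE {c : Fin p // c ≠ a}),
                  (∀ (s₁ s₂ : ℤ) (i j : Fin 1),
                    entE Taa s₁ s₂ i j = Cr (s₁ - s₂) ((t : ℝ) / (N : ℝ)) a a) →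
                  (∀ (s₁ s₂ : ℤ) (i : Fin 1) (c : {c : Fin p // c ≠ a}),
                    entE TaSp s₁ s₂ i c =
                      Cr (s₁ - s₂) ((t : ℝ) / (N : ℝ)) a (c : Fin p)) →
                  (∀ (s₁ s₂ : ℤ) (c c' : {c : Fin p // c ≠ a}),
                    entE TSpSp s₁ s₂ c c' =
                      Cr (s₁ - s₂) ((t : ℝ) / (N : ℝ)) (c : Fin p) (c' : Fin p)) →
                  TSpSp.comp F = ContinuousLinearMap.id ℝ _ →
                  F.comp TSpSp = ContinuousLinearMap.id ℝ _ →
                  |schurEnt Caa CaSp E t τ - schurEnt Taa TaSp F t τ| ≤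
                    𝒦 * zeta ((t : ℝ) - (τ : ℝ)) ^ (κ - 2) *
                      min (1 / (N : ℝ)) (zeta ((t : ℝ) - (τ : ℝ)))) ∧
                -- (3.13): Lipschitz continuity in `u`
                (∀ (u v : ℝ)
                  (Uaa : HE (Fin 1) →L[ℝ] HE (Fin 1))
                  (UaSp : HE {c : Fin p // c ≠ a} →L[ℝ] HE (Fin 1))
                  (USpSp F : HE {c : Fin p // c ≠ a} →L[ℝ] HE {c : Fin p // c ≠ a})
                  (Vaa : HE (Fin 1) →L[ℝ] HE (Fin 1))
                  (VaSp : HE {c : Fin p // c ≠ a} →L[ℝ] HE (Fin 1))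
                  (VSpSp G : HE {c : Fin p // c ≠ a} →L[ℝ] HE {c : Fin p // c ≠ a}),
                  (∀ (s₁ s₂ : ℤ) (i j : Fin 1),
                    entE Uaa s₁ s₂ i j = Cr (s₁ - s₂) u a a) →
                  (∀ (s₁ s₂ : ℤ) (i : Fin 1) (c : {c : Fin p // c ≠ a}),
                    entE UaSp s₁ s₂ i c = Cr (s₁ - s₂) u a (c : Fin p)) →
                  (∀ (s₁ s₂ : ℤ) (c c' : {c : Fin p // c ≠ a}),
                    entE USpSp s₁ s₂ c c' = Cr (s₁ - s₂) u (c : Fin p) (c' : Fin p)) →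
                  USpSp.comp F = ContinuousLinearMap.id ℝ _ →
                  F.comp USpSp = ContinuousLinearMap.id ℝ _ →
                  (∀ (s₁ s₂ : ℤ) (i j : Fin 1),
                    entE Vaa s₁ s₂ i j = Cr (s₁ - s₂) v a a) →
                  (∀ (s₁ s₂ : ℤ) (i : Fin 1) (c : {c : Fin p // c ≠ a}),
                    entE VaSp s₁ s₂ i c = Cr (s₁ - s₂) v a (c : Fin p)) →
                  (∀ (s₁ s₂ : ℤ) (c c' : {c : Fin p // c ≠ a}),
                    entE VSpSp s₁ s₂ c c' = Cr (s₁ - s₂) v (c : Fin p) (c' : Fin p)) →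
                  VSpSp.comp G = ContinuousLinearMap.id ℝ _ →
                  G.comp VSpSp = ContinuousLinearMap.id ℝ _ →
                  ∀ t τ : ℤ,
                    |schurEnt Uaa UaSp F t τ - schurEnt Vaa VaSp G t τ| ≤
                      𝒦 * |u - v| * zeta ((t : ℝ) - (τ : ℝ)) ^ (κ - 1)) := by
  by_cases hK : 0 ≤ K
  swap
  · exact ⟨1, one_pos, fun p _ C Cr hLS => absurd hLS.nonneg hK⟩
  obtain ⟨Λ₀, hΛ₀, h₀⟩ := exists_schurEnt_bounds K κ lamInf 0 hK hκ hInf le_rfl zero_le_one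
  obtain ⟨Λ₁, hΛ₁, h₁⟩ := exists_schurEnt_bounds K κ lamInf 1 hK hκ hInf zero_le_one le_rfl
  refine ⟨Λ₀ * K + 3 * Λ₁ * K + 2 * Λ₁ + 1, by positivity, ?_⟩
  intro p _ C Cr hLS a N hN hN1 Caa CaSp CSpSp E haa haS hSS hinv hinv'
  have hC : PartialSystem a (blk (C N)) Caa CaSp CSpSp E := ⟨haa, haS, hSS, hinv, hinv'⟩
  refine ⟨?_, ?_⟩
  · intro t τ Taa TaSp TSpSp F kaa kaS kSS kinv kinv'
    have hT : PartialSystem a (fun s σ => Cr (s - σ) ((t : ℝ) / N)) Taa TaSp TSpSp F :=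
      ⟨kaa, kaS, kSS, kinv, kinv'⟩
    obtain ⟨b₁, b₂, b₃⟩ := h₁ p a _ _ Caa Taa CaSp TaSp CSpSp TSpSp E F hC hT
      (hLS.blockCoercive_blk hN) (hLS.blockCoercive_toeplitz (by linarith) _)
      (hLS.decay N hN1) (hLS.specNorm_toeplitz_le _) t τ
    have b₄ := b₃ (3 * K * (1 / N)) (by positivity)
      (fun s σ => (hLS.specNorm_blk_sub_toeplitz_le hN1 t s σ).1)
      (fun s σ => (hLS.specNorm_blk_sub_toeplitz_le hN1 t s σ).2)
    have hz := zeta_pos ((t : ℝ) - τ)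
    have hz2 : 0 ≤ zeta ((t : ℝ) - τ) ^ (κ - 2) := by positivity
    rcases min_choice (1 / (N : ℝ)) (zeta ((t : ℝ) - τ)) with hmin | hmin <;> rw [hmin]
    · have hw : polyWeight (κ - 1 - 1) t τ ≤ zeta ((t : ℝ) - τ) ^ (κ - 2) := by
        have := polyWeight_le_zeta_rpow (b := κ - 2) (by linarith) t τ
        rwa [show κ - 1 - 1 = κ - 2 by ring]
      calc _ ≤ Λ₁ * (3 * K * (1 / N)) * zeta ((t : ℝ) - τ) ^ (κ - 2) := b₄.trans (by gcongr)
        _ = 3 * Λ₁ * K * zeta ((t : ℝ) - τ) ^ (κ - 2) * (1 / N) := by ring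
        _ ≤ _ := by
          gcongr
          nlinarith [mul_nonneg hΛ₀ hK]
    · have hw : polyWeight (κ - 1) t τ ≤ zeta ((t : ℝ) - τ) ^ (κ - 2) * zeta ((t : ℝ) - τ) := by
        have := polyWeight_le_zeta_rpow (b := κ - 1) (by linarith) t τ
        rwa [← Real.rpow_add_one hz.ne', show κ - 2 + 1 = κ - 1 by ring]
      calc _ ≤ Λ₁ * polyWeight (κ - 1) t τ + Λ₁ * polyWeight (κ - 1) t τ :=
            (abs_sub _ _).trans (add_le_add b₁ b₂)
        _ = 2 * Λ₁ * polyWeight (κ - 1) t τ := by ring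
        _ ≤ 2 * Λ₁ * (zeta ((t : ℝ) - τ) ^ (κ - 2) * zeta ((t : ℝ) - τ)) := by gcongr
        _ = 2 * Λ₁ * zeta ((t : ℝ) - τ) ^ (κ - 2) * zeta ((t : ℝ) - τ) := by ring
        _ ≤ _ := by
          gcongr
          nlinarith [mul_nonneg hΛ₀ hK, mul_nonneg hΛ₁ hK]
  · intro u v Uaa UaSp USpSp F Vaa VaSp VSpSp G uaa uaS uSS uinv uinv' vaa vaS vSS vinv vinv' t τ
    have hU : PartialSystem a (fun s σ => Cr (s - σ) u) Uaa UaSp USpSp F :=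
      ⟨uaa, uaS, uSS, uinv, uinv'⟩
    have hV : PartialSystem a (fun s σ => Cr (s - σ) v) Vaa VaSp VSpSp G :=
      ⟨vaa, vaS, vSS, vinv, vinv'⟩
    obtain ⟨-, -, b₃⟩ := h₀ p a _ _ Uaa Vaa UaSp VaSp USpSp VSpSp F G hU hV
      (hLS.blockCoercive_toeplitz (by linarith) _) (hLS.blockCoercive_toeplitz (by linarith) _)
      (hLS.specNorm_toeplitz_le _) (hLS.specNorm_toeplitz_le _) t τ
    have hd : ∀ s σ : ℤ, specNorm (Cr (s - σ) u - Cr (s - σ) v) ≤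
        K * |u - v| * polyWeight (κ - 1) s σ := fun s σ => by
      have h := hLS.crLip (s - σ) u v
      rw [Int.cast_sub] at h
      refine h.trans ?_
      gcongr
      exact polyWeight_anti (by linarith) s σ
    have b₄ := b₃ (K * |u - v|) (by positivity)
      (fun s σ => by rw [Real.rpow_zero, one_mul]; exact hd s σ)
      (fun s σ => by rw [Real.rpow_zero, one_mul, polyWeight_comm]; exact hd σ s)
    rw [sub_zero] at b₄
    have hz := zeta_pos ((t : ℝ) - τ)
    calc _ ≤ Λ₀ * (K * |u - v|) * zeta ((t : ℝ) - τ) ^ (κ - 1) := by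
          refine b₄.trans ?_
          gcongr
          exact polyWeight_le_zeta_rpow (by linarith) t τ
      _ = Λ₀ * K * |u - v| * zeta ((t : ℝ) - τ) ^ (κ - 1) := by ring
      _ ≤ _ := by
          gcongr
          nlinarith [mul_nonneg hΛ₁ hK]
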